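/- Let Φ = B_n or C_n, let I, J ⊆ Δ, and let λ̄ be a dominant integral weight with Φ_{λ̄} = Φ_J. Then there exist a Φ_I-regular weight μ and indices k_1, …, k_{m−1} with q_{s−1} < k_s ≤ q_s for 1 ≤ s < m, such that for every Φ_I-regular weight λ ∈ Wλ̄ there are ε_1, …, ε_{m−1} ∈ {0, 1} with λ ⟷ s_{e_{k_1}}^{ε_1} s_{e_{k_2}}^{ε_2} ⋯ s_{e_{k_{m−1}}}^{ε_{m−1}} μ. Moreover, whenever ε_s = 1, one has μ_{k_s} ≠ 0 and s_{e_{k_s}}μ is Φ_I-regular. -/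

import Mathlib

namespace JantzenBlocks

open scoped Classical

/-- The three classical types `B`, `C`, `D`. -/
inductive CType : Type
  | B | C | D
deriving DecidableEq

/-- The weight space `ℝ^n`. -/
abbrev V (n : ℕ) := Fin n → ℝ

noncomputable section

/-- The standard inner product on `ℝ^n`. -/
def inn {n : ℕ} (x y : V n) : ℝ := ∑ i, x i * y i

/-- The standard basis vector `e i`. -/
def ee {n : ℕ} (i : Fin n) : V n := Pi.single i 1

/-- The reflection `s_v` in the vector `v`. -/
def sRefl {n : ℕ} (v x : V n) : V n := x - (2 * inn x v / inn v v) • v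

/-- The roots `±e_i ± e_j` (`i ≠ j`), i.e. the root system of type `D_n`. -/
def DRoots (n : ℕ) : Set (V n) :=
  {v | ∃ i j : Fin n, i ≠ j ∧ (v = ee i + ee j ∨ v = ee i - ee j ∨ v = -ee i - ee j)}

/-- The ambient root system `Φ` of type `B_n`, `C_n` or `D_n`. -/
def Phi (n : ℕ) : CType → Set (V n)
  | CType.B => DRoots n ∪ {v | ∃ i : Fin n, v = ee i ∨ v = -ee i}
  | CType.C => DRoots n ∪ {v | ∃ i : Fin n, v = (2:ℝ) • ee i ∨ v = -((2:ℝ) • ee i)}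
  | CType.D => DRoots n

/-- The standard positive system `Φ⁺`: roots whose first nonzero coordinate is positive. -/
def PhiPos (n : ℕ) (ct : CType) : Set (V n) :=
  {v | v ∈ Phi n ct ∧ ∃ i : Fin n, 0 < v i ∧ ∀ j : Fin n, j < i → v j = 0}

/-- The simple root `α_{i+1}` (`0`-based index `i`). -/
def alphaR (n : ℕ) (ct : CType) (i : Fin n) : V n :=
  if h : i.1 + 1 < n then ee i - ee ⟨i.1 + 1, h⟩
  else
    match ct with
    | CType.B => ee i
    | CType.C => (2:ℝ) • ee i
    | CType.D => ee ⟨n - 2, Nat.sub_lt i.pos (by norm_num)⟩ + ee i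

/-- The subsystem `Φ_I` generated by the simple roots indexed by `I`. -/
def PhiI (n : ℕ) (ct : CType) (I : Finset (Fin n)) : Set (V n) :=
  Phi n ct ∩ (Submodule.span ℝ (alphaR n ct '' (I : Set (Fin n))) : Set (V n))

/-- `λ` is `Φ_I`-regular. -/
def RegI (n : ℕ) (ct : CType) (I : Finset (Fin n)) (lam : V n) : Prop :=
  ∀ β ∈ PhiI n ct I, inn lam β ≠ 0

/-- `λ` is integral. -/
def IntegralW (n : ℕ) (ct : CType) (lam : V n) : Prop :=
  ∀ β ∈ Phi n ct, ∃ k : ℤ, 2 * inn lam β / inn β β = (k : ℝ)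

/-- `λ` is dominant. -/
def DominantW (n : ℕ) (ct : CType) (lam : V n) : Prop :=
  ∀ i : Fin n, 0 ≤ inn lam (alphaR n ct i)

/-- `μ` lies in the `W_I`-orbit of `λ` (`W_I` generated by the reflections `s_α`, `α ∈ I`). -/
def WIOrb (n : ℕ) (ct : CType) (I : Finset (Fin n)) : V n → V n → Prop :=
  Relation.ReflTransGen (fun x y => ∃ i ∈ I, y = sRefl (alphaR n ct i) x)

/-- `μ` lies in the `W`-orbit of `λ`. -/
def WOrb (n : ℕ) (ct : CType) : V n → V n → Prop := WIOrb n ct Finset.univ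

/-- `λ ∈ Λ_I⁺`. -/
def LamIPlus (n : ℕ) (ct : CType) (I : Finset (Fin n)) (lam : V n) : Prop :=
  IntegralW n ct lam ∧ ∀ i ∈ I, 0 < inn lam (alphaR n ct i)

/-- The sorted list `q_1 < q_2 < … < q_{m-1}` (`1`-based values) of indices of `Δ∖I`. -/
def Qlist (n : ℕ) (I : Finset (Fin n)) : List ℕ :=
  ((Finset.univ \ I).sort (· ≤ ·)).map (fun j => j.1 + 1)

/-- The number `m` of segments determined by `I`. -/
def mval (n : ℕ) (I : Finset (Fin n)) : ℕ := (Qlist n I).length + 1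

/-- `q_s`, with the conventions `q_0 = 0` and `q_m = n`. -/
def qval (n : ℕ) (I : Finset (Fin n)) (s : ℕ) : ℕ :=
  if s = 0 then 0 else if s < mval n I then (Qlist n I).getD (s - 1) 0 else n

/-- `I` is standard (automatic in types `B`, `C`). -/
def StandardI (n : ℕ) (ct : CType) (I : Finset (Fin n)) : Prop :=
  ct = CType.D → ∀ h : 2 ≤ n,
    ((⟨n - 2, by omega⟩ : Fin n) ∈ I ∨ (⟨n - 1, by omega⟩ : Fin n) ∉ I)

/-- `q_s`, corrected for nonstandard `I` (where `q_{m-1}` is replaced by `n`,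
so that the `(m-1)`-st segment is `(q_{m-2}, n]` and the `m`-th segment is empty). -/
def qv (n : ℕ) (ct : CType) (I : Finset (Fin n)) (s : ℕ) : ℕ :=
  if ¬ StandardI n ct I ∧ s = mval n I - 1 then n else qval n I s

/-- The segment length `n_s`. -/
def nsval (n : ℕ) (ct : CType) (I : Finset (Fin n)) (s : ℕ) : ℕ :=
  qv n ct I s - qv n ct I (s - 1)

/-- The (`0`-based) index `i` lies in the `s`-th segment, i.e. `q_{s-1} < i+1 ≤ q_s`. -/
def InSeg (n : ℕ) (ct : CType) (I : Finset (Fin n)) (s : ℕ) (i : Fin n) : Prop :=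
  qv n ct I (s - 1) < i.1 + 1 ∧ i.1 + 1 ≤ qv n ct I s

/-- `n_s^λ(a)`: the number of entries of the `s`-th segment of `λ` with absolute value `a`. -/
def nsl (n : ℕ) (ct : CType) (I : Finset (Fin n)) (lam : V n) (s : ℕ) (a : ℝ) : ℕ :=
  (Finset.univ.filter (fun i : Fin n => InSeg n ct I s i ∧ |lam i| = a)).card

/-- `a_t = λ̄_{q̄_t}` for `1 ≤ t < m̄`, and `a_{m̄} = 0`. -/
def aval (n : ℕ) (ct : CType) (J : Finset (Fin n)) (lbar : V n) (t : ℕ) : ℝ :=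
  if t < mval n J then
    (if h : qv n ct J t - 1 < n then lbar ⟨qv n ct J t - 1, h⟩ else 0)
  else 0

/-- `n_s^λ(a)` is maximal among all `Φ_I`-regular weights in the orbit of `λ`. -/
def IsMaxN (n : ℕ) (ct : CType) (I : Finset (Fin n)) (lam : V n) (s : ℕ) (a : ℝ) : Prop :=
  ∀ mu : V n, WOrb n ct lam mu → RegI n ct I mu →
    nsl n ct I mu s a ≤ nsl n ct I lam s a

/-- The exceptional configurations of Proposition 4.7 (types `B` and `C`, with
`shortR i` the short/long root `e_i` resp. `2e_i`). -/
def ExcBC (n : ℕ) (ct : CType) (I : Finset (Fin n)) (shortR : Fin n → V n)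
    (lam β : V n) : Prop :=
  ∃ s : ℕ, 1 ≤ s ∧ s < mval n I ∧ ∃ a : ℝ, 0 < a ∧
    nsl n ct I lam s a = 1 ∧
    nsl n ct I lam s 0 + nsl n ct I lam (mval n I) a = 1 ∧
    ((∃ i j : Fin n, InSeg n ct I s i ∧ InSeg n ct I s j ∧
        |lam i| = a ∧ lam j = 0 ∧ (β = shortR i ∨ β = ee i + ee j)) ∨
     (∃ i j : Fin n, InSeg n ct I s i ∧ InSeg n ct I (mval n I) j ∧
        ((lam i = a ∧ lam j = a) ∨ (lam i = -a ∧ lam j = -a)) ∧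
        (β = shortR i ∨ β = ee i + ee j)) ∨
     (∃ i j : Fin n, InSeg n ct I s i ∧ InSeg n ct I (mval n I) j ∧
        ((lam i = a ∧ lam j = -a) ∨ (lam i = -a ∧ lam j = a)) ∧
        (β = shortR i ∨ β = ee i - ee j)))

/-- The exceptional configurations of Proposition 4.7 (type `D`). -/
def ExcD (n : ℕ) (I : Finset (Fin n)) (lam β : V n) : Prop :=
  ∃ s : ℕ, 1 ≤ s ∧ s < mval n I ∧ ∃ a : ℝ, 0 < a ∧
    nsl n CType.D I lam s a = 1 ∧ nsl n CType.D I lam (mval n I) a = 1 ∧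
    nsl n CType.D I lam s 0 = 1 ∧ nsl n CType.D I lam (mval n I) 0 = 1 ∧
    ∃ i j k l : Fin n, InSeg n CType.D I s i ∧ InSeg n CType.D I s j ∧
      InSeg n CType.D I (mval n I) k ∧ InSeg n CType.D I (mval n I) l ∧
      lam j = 0 ∧ lam l = 0 ∧
      ((((lam i = a ∧ lam k = a) ∨ (lam i = -a ∧ lam k = -a)) ∧
          (β = ee i + ee j ∨ β = ee i + ee k)) ∨
       (((lam i = a ∧ lam k = -a) ∨ (lam i = -a ∧ lam k = a)) ∧
          (β = ee i + ee j ∨ β = ee i - ee k)))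

/-- The exceptional configurations in which `β` fails to be a linked root. -/
def Exc (n : ℕ) (ct : CType) (I : Finset (Fin n)) (lam β : V n) : Prop :=
  match ct with
  | CType.B => ExcBC n CType.B I (fun i => ee i) lam β
  | CType.C => ExcBC n CType.C I (fun i => (2:ℝ) • ee i) lam β
  | CType.D => ExcD n I lam β

/-- `β` is a linked root of the `Φ_I`-regular weight `λ` (for standard `I`). -/
def PlainLinked (n : ℕ) (ct : CType) (I : Finset (Fin n)) (lam β : V n) : Prop :=
  RegI n ct I lam ∧ β ∈ PhiPos n ct ∧ β ∉ PhiI n ct I ∧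
  RegI n ct I (sRefl β lam) ∧ sRefl β lam ≠ lam ∧ ¬ Exc n ct I lam β

/-- The transposition of the last two indices. -/
def swapLast (n : ℕ) (j : Fin n) : Fin n :=
  if j.1 = n - 1 then ⟨n - 2, Nat.sub_lt j.pos (by norm_num)⟩
  else if j.1 = n - 2 then ⟨n - 1, Nat.sub_lt j.pos (by norm_num)⟩
  else j

/-- The isomorphism `φ = s_{e_n}` (negating the last coordinate). -/
def phiW {n : ℕ} (x : V n) : V n := fun j => if j.1 = n - 1 then -x j else x j

/-- The image `φ(I)` of an index set under `φ` (interchanging `α_{n-1}` and `α_n`). -/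
def phiIdx (n : ℕ) (I : Finset (Fin n)) : Finset (Fin n) := I.image (swapLast n)

/-- `β` is a linked root of `λ`; for nonstandard `I` the notion is transported along `φ`. -/
def LinkedRoot (n : ℕ) (ct : CType) (I : Finset (Fin n)) (lam β : V n) : Prop :=
  if StandardI n ct I then PlainLinked n ct I lam β
  else PlainLinked n ct (phiIdx n I) (phiW lam) (phiW β)

/-- One step in a connecting chain: `y ∈ W_I x`, or `y = w s_β x` for a linked root `β` of `x`. -/
def ConnStep (n : ℕ) (ct : CType) (I : Finset (Fin n)) (x y : V n) : Prop :=
  RegI n ct I x ∧ RegI n ct I y ∧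
  (WIOrb n ct I x y ∨ ∃ β : V n, LinkedRoot n ct I x β ∧ WIOrb n ct I (sRefl β x) y)

/-- `λ ⟷ μ`: `λ` and `μ` are connected by a chain of linked roots. -/
def Conn (n : ℕ) (ct : CType) (I : Finset (Fin n)) (lam mu : V n) : Prop :=
  RegI n ct I lam ∧ RegI n ct I mu ∧
  Relation.ReflTransGen (ConnStep n ct I) lam mu

/-- The set `^IW^Jλ̄ = Wλ̄ ∩ Λ_I⁺` of weights parametrizing the simple modules. -/
def IWJset (n : ℕ) (ct : CType) (I : Finset (Fin n)) (lbar : V n) : Set (V n) :=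
  {mu | WOrb n ct lbar mu ∧ LamIPlus n ct I mu}

/-- `(S, S̄)` is a separable pair for the weight `λ`. -/
def IsSepPair (n : ℕ) (ct : CType) (I J : Finset (Fin n)) (lbar lam : V n)
    (S Sb : Finset ℕ) : Prop :=
  S.Nonempty ∧ Sb.Nonempty ∧
  S ⊆ Finset.Icc 1 (mval n I) ∧ Sb ⊆ Finset.Icc 1 (mval n J) ∧
  1 < mval n I ∧ 1 < mval n J ∧
  (∀ s ∈ S, ∀ t ∈ Sb, IsMaxN n ct I lam s (aval n ct J lbar t)) ∧
  (∀ s ∈ Finset.Icc 1 (mval n I), s ∉ S →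
     ∀ t ∈ Finset.Icc 1 (mval n J), t ∉ Sb →
       nsl n ct I lam s (aval n ct J lbar t) = 0) ∧
  (match ct with
   | CType.B => (mval n I ∈ S ↔ mval n J ∉ Sb)
   | CType.C => (mval n I ∈ S ↔ mval n J ∉ Sb)
   | CType.D => (mval n I ∈ S ↔ mval n J ∈ Sb))

/-- `𝒟`: the set of separable pairs of the system `(Φ, Φ_I, Φ_J)`. -/
def DSet (n : ℕ) (ct : CType) (I J : Finset (Fin n)) (lbar : V n) :
    Set (Finset ℕ × Finset ℕ) :=
  {p | ∀ lam ∈ IWJset n ct I lbar, IsSepPair n ct I J lbar lam p.1 p.2}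

/-- The four weakly separable pairs. -/
def IsWeakPair (n : ℕ) (I J : Finset (Fin n)) (p : Finset ℕ × Finset ℕ) : Prop :=
  p = (Finset.Icc 1 (mval n I - 1), {mval n J}) ∨
  p = (Finset.Icc 1 (mval n I), {mval n J}) ∨
  p = ({mval n I}, Finset.Icc 1 (mval n J - 1)) ∨
  p = ({mval n I}, Finset.Icc 1 (mval n J))

/-- The system `(Φ, Φ_I, Φ_J)` is separable. -/
def SepSys (n : ℕ) (ct : CType) (I J : Finset (Fin n)) (lbar : V n) : Prop :=
  (DSet n ct I J lbar).Nonempty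

/-- The system `(Φ, Φ_I, Φ_J)` is strongly separable. -/
def StronglySepSys (n : ℕ) (ct : CType) (I J : Finset (Fin n)) (lbar : V n) : Prop :=
  ∃ p ∈ DSet n ct I J lbar, ¬ IsWeakPair n I J p

/-- The system `(Φ, Φ_I, Φ_J)` is weakly separable. -/
def WeaklySepSys (n : ℕ) (ct : CType) (I J : Finset (Fin n)) (lbar : V n) : Prop :=
  SepSys n ct I J lbar ∧ ∀ p ∈ DSet n ct I J lbar, IsWeakPair n I J p

/-- The partial ordering on separable pairs: `(S₁,S̄₁) ≤ (S₂,S̄₂)` iff `S₁ ⊆ S₂`, `S̄₁ ⊇ S̄₂`. -/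
def pairLE (p q : Finset ℕ × Finset ℕ) : Prop := p.1 ⊆ q.1 ∧ q.2 ⊆ p.2

/-- Strict version of `pairLE`. -/
def pairLT (p q : Finset ℕ × Finset ℕ) : Prop := pairLE p q ∧ p ≠ q

/-- The generating relations of the equivalence `∼` on `𝒟`. -/
def PairRel (D : Set (Finset ℕ × Finset ℕ)) (p q : Finset ℕ × Finset ℕ) : Prop :=
  p ∈ D ∧ q ∈ D ∧ ((p.2 = q.2 ∧ p.1 ⊆ q.1) ∨ (p.1 = q.1 ∧ p.2 ⊆ q.2))

/-- The equivalence relation `∼` on separable pairs. -/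
def PairEquiv (D : Set (Finset ℕ × Finset ℕ)) :
    Finset ℕ × Finset ℕ → Finset ℕ × Finset ℕ → Prop :=
  Relation.EqvGen (PairRel D)

/-- A trivial separable pair. -/
def TrivialPair (n : ℕ) (ct : CType) (I J : Finset (Fin n)) (lbar : V n)
    (p : Finset ℕ × Finset ℕ) : Prop :=
  match ct with
  | CType.B | CType.C =>
    (∃ s0 : ℕ, 1 ≤ s0 ∧ s0 < mval n I ∧
       PairEquiv (DSet n ct I J lbar) p ({s0}, Finset.Icc 1 (mval n J))) ∨
    (∃ t0 : ℕ, 1 ≤ t0 ∧ t0 < mval n J ∧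
       PairEquiv (DSet n ct I J lbar) p (Finset.Icc 1 (mval n I), {t0}))
  | CType.D =>
    (∃ s0 : ℕ, 1 ≤ s0 ∧ s0 < mval n I ∧
       PairEquiv (DSet n ct I J lbar) p ({s0}, Finset.Icc 1 (mval n J - 1))) ∨
    (∃ t0 : ℕ, 1 ≤ t0 ∧ t0 < mval n J ∧
       PairEquiv (DSet n ct I J lbar) p (Finset.Icc 1 (mval n I - 1), {t0}))

/-- The set of blocks: equivalence classes of `^IW^Jλ̄` under `⟷`. -/
def BlockSet (n : ℕ) (ct : CType) (I : Finset (Fin n)) (lbar : V n) : Set (Set (V n)) :=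
  {Cl | ∃ lam ∈ IWJset n ct I lbar,
     Cl = {mu | mu ∈ IWJset n ct I lbar ∧ Conn n ct I lam mu}}

/-- The parity `P(λ)` of the number of negative entries of `λ`. -/
def Pfun (n : ℕ) (lam : V n) : ℕ :=
  (Finset.univ.filter (fun i : Fin n => lam i < 0)).card % 2

/-- A fundamental chain `c 1 ∼ c 2 ∼ … ∼ c k` in `𝒟`. -/
def IsFundChain (D : Set (Finset ℕ × Finset ℕ)) (c : ℕ → Finset ℕ × Finset ℕ)
    (k : ℕ) : Prop :=
  1 ≤ k ∧ (∀ i, 1 ≤ i → i ≤ k → c i ∈ D) ∧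
  (∀ i, 1 ≤ i → i < k →
     ((c i).1 = (c (i+1)).1 ∨ (c i).2 = (c (i+1)).2) ∧
     (pairLT (c i) (c (i+1)) ∨ pairLT (c (i+1)) (c i)))

/-- The list of parts of the partition `π_I`. -/
def piParts (n : ℕ) (ct : CType) (I : Finset (Fin n)) : List ℕ :=
  (List.range (mval n I - 1)).map (fun s => nsval n ct I (s+1)) ++
  (List.range (mval n I - 1)).map (fun s => nsval n ct I (s+1)) ++
  (match ct with
   | CType.B => [2 * nsval n ct I (mval n I) + 1]
   | CType.C => [2 * nsval n ct I (mval n I)]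
   | CType.D => if nsval n ct I (mval n I) = 0 then []
                else [2 * nsval n ct I (mval n I) - 1, 1])

/-- The `i`-th part (`1`-based) of the partition with list of parts `L`. -/
def partAt (L : List ℕ) (i : ℕ) : ℕ :=
  (L.mergeSort (fun a b => decide (b ≤ a))).getD (i - 1) 0

/-- The `i`-th part (`1`-based) of the dual partition `π^t`: the number of parts `≥ i`. -/
def dualAt (L : List ℕ) (i : ℕ) : ℕ :=
  (L.filter (fun x => decide (i ≤ x))).length

/-- `k` is compatible with the system `(Φ, Φ_I, Φ_J)`. -/
def CompatibleK (n : ℕ) (ct : CType) (I J : Finset (Fin n)) (k : ℕ) : Prop :=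
  1 ≤ k ∧ k ≤ 2 * mval n I - 1 ∧
  (match ct with
   | CType.B =>
     (Odd k ∧ k ≤ partAt (piParts n CType.B J) 2 ∧
        2 * nsval n CType.B J (mval n J) + 1 ≤ k ∧
        partAt (piParts n CType.B I) k ≤ 2 * nsval n CType.B I (mval n I) + 1) ∨
     (Even k ∧ k ≤ 2 * nsval n CType.B J (mval n J) ∧
        2 * nsval n CType.B I (mval n I) + 1 ≤ partAt (piParts n CType.B I) k)
   | CType.C =>
     (Odd k ∧ k ≤ partAt (piParts n CType.C J) 2 ∧
        2 * nsval n CType.C J (mval n J) + 1 ≤ k ∧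
        partAt (piParts n CType.C I) k ≤ 2 * nsval n CType.C I (mval n I)) ∨
     (Even k ∧ k ≤ 2 * nsval n CType.C J (mval n J) ∧
        2 * nsval n CType.C I (mval n I) + 1 ≤ partAt (piParts n CType.C I) k)
   | CType.D =>
     (Even k ∧ k ≤ partAt (piParts n CType.D J) 2 ∧
        2 * nsval n CType.D J (mval n J) ≤ k ∧
        2 * nsval n CType.D I (mval n I) ≤ partAt (piParts n CType.D I) k) ∨
     (Odd k ∧ k ≤ 2 * nsval n CType.D J (mval n J) - 1 ∧
        partAt (piParts n CType.D I) k ≤ 2 * nsval n CType.D I (mval n I) - 1))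

/-- `s_{e_{k_1}}^{ε_1} ⋯ s_{e_{k_r}}^{ε_r} μ`. -/
def applyFlips (n : ℕ) (ks : ℕ → Fin n) (eps : ℕ → Bool) : ℕ → V n → V n
  | 0, v => v
  | (r+1), v =>
      if eps (r+1) then sRefl (ee (ks (r+1))) (applyFlips n ks eps r v)
      else applyFlips n ks eps r v

end


theorem bal_path {ρ κ : Type} [Fintype ρ] [Fintype κ]
    (D : ρ → κ → ℤ) (hrow : ∀ s, ∑ a, D s a = 0) (hcol : ∀ a, ∑ s, D s a = 0)
    (s1 : ρ) (a2 : κ) (h : D s1 a2 < 0) :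
    ∃ a1, 0 < D s1 a1 ∧
      Relation.ReflTransGen (fun a a' => ∃ r, 0 < D r a ∧ D r a' < 0) a2 a1 := by
  set P : κ → Prop := fun a =>
    Relation.ReflTransGen (fun a a' => ∃ r, 0 < D r a ∧ D r a' < 0) a2 a with hP
  by_contra hcon
  push Not at hcon
  have key : ∀ r, ∑ a ∈ Finset.univ.filter P, D r a ≤ 0 := by
    intro r
    by_cases hr : ∃ a, P a ∧ 0 < D r a
    · obtain ⟨a, ha, hpos⟩ := hr
      have h1 := Finset.sum_filter_add_sum_filter_not Finset.univ P (fun a => D r a)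
      rw [hrow r] at h1
      have h2 : 0 ≤ ∑ a ∈ Finset.univ.filter (fun a => ¬ P a), D r a := by
        apply Finset.sum_nonneg
        intro b hb
        by_contra hneg
        exact (Finset.mem_filter.1 hb).2 (Relation.ReflTransGen.tail ha ⟨r, hpos, not_le.1 hneg⟩)
      linarith
    · push Not at hr
      exact Finset.sum_nonpos fun a ha => hr a (Finset.mem_filter.1 ha).2
  have hs1 : ∑ a ∈ Finset.univ.filter P, D s1 a < 0 := by
    apply Finset.sum_neg'
    · intro a ha
      by_contra hc
      exact hcon a (not_le.1 hc) (Finset.mem_filter.1 ha).2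
    · exact ⟨a2, Finset.mem_filter.2 ⟨Finset.mem_univ _, Relation.ReflTransGen.refl⟩, h⟩
  have htot : ∑ r, ∑ a ∈ Finset.univ.filter P, D r a = 0 := by
    rw [Finset.sum_comm]
    exact Finset.sum_eq_zero fun a _ => hcol a
  have : ∑ r, ∑ a ∈ Finset.univ.filter P, D r a < 0 :=
    Finset.sum_neg' (fun r _ => key r) ⟨s1, Finset.mem_univ _, hs1⟩
  omega

theorem rtg_path {κ : Type} {ρ : Type} [Nonempty ρ] (D : ρ → κ → ℤ) (a b : κ)
    (h : Relation.ReflTransGen (fun a a' => ∃ r, 0 < D r a ∧ D r a' < 0) a b) :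
    ∃ (l : ℕ) (c : ℕ → κ) (r : ℕ → ρ), c 0 = a ∧ c l = b ∧
      ∀ i < l, 0 < D (r i) (c i) ∧ D (r i) (c (i+1)) < 0 := by
  induction h using Relation.ReflTransGen.head_induction_on with
  | refl => exact ⟨0, fun _ => b, fun _ => Classical.arbitrary ρ, rfl, rfl, by simp⟩
  | @head a' c' h1 _ ih =>
    obtain ⟨r0, h2, h3⟩ := h1
    obtain ⟨l, c, r, e1, e2, h⟩ := ih
    refine ⟨l+1, fun i => Nat.casesOn i a' c, fun i => Nat.casesOn i r0 r, rfl, e2, ?_⟩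
    intro i hi
    rcases i with _ | i
    · simp only [e1]; exact ⟨h2, h3⟩
    · exact h i (by omega)

theorem abs_main {X ρ κ : Type} [Fintype ρ] [Fintype κ]
    (top : ρ) (z : κ → ℤ) (hz : ∀ a, z a = 0 ∨ z a = 1) (Cn : X → X → Prop)
    (hrefl : ∀ x, Cn x x) (htrans : ∀ x y w, Cn x y → Cn y w → Cn x w)
    (M : X → ρ → κ → ℤ) (cap : ρ → κ → ℤ)
    (hcapd : ∀ s a, cap s a = 2 - (if s = top then 1 else 0) - z a)
    (hM0 : ∀ x s a, 0 ≤ M x s a) (hcap : ∀ x s a, M x s a ≤ cap s a)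
    (hrow : ∀ x y s, ∑ a, M x s a = ∑ a, M y s a)
    (hcol : ∀ x y a, ∑ s, M x s a = ∑ s, M y s a)
    (real : ∀ x s t a b, s ≠ t → a ≠ b → 1 ≤ M x s a → 1 ≤ M x t b →
      M x s b < cap s b → M x t a < cap t a →
      ¬ (M x s a = 1 ∧ M x t b = 1 ∧ M x s b = 1 ∧ M x t a = 1) →
      ∃ y, Cn x y ∧ M y s a = M x s a - 1 ∧ M y s b = M x s b + 1 ∧
        M y t a = M x t a + 1 ∧ M y t b = M x t b - 1 ∧
        ∀ r c, ¬ ((r = s ∨ r = t) ∧ (c = a ∨ c = b)) → M y r c = M x r c)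
    (x0 : X) : ∃ mu, ∀ x, ∃ y, Cn x y ∧ M y = M mu := by
  -- sums over four cells
  have four : ∀ (G H : ρ → κ → ℤ) (s t : ρ) (a b : κ), s ≠ t → a ≠ b →
      (∀ r c, ¬ ((r = s ∨ r = t) ∧ (c = a ∨ c = b)) → H r c = G r c) →
      ∑ r, ∑ c, H r c - ∑ r, ∑ c, G r c =
        (H s a - G s a) + (H s b - G s b) + (H t a - G t a) + (H t b - G t b) := by
    intro G H s t a b hst hab hoff
    have h1 : ∑ r, ∑ c, H r c - ∑ r, ∑ c, G r c = ∑ r, ∑ c, (H r c - G r c) := by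
      simp only [Finset.sum_sub_distrib]
    rw [h1, ← Finset.sum_subset (Finset.subset_univ {s, t}), Finset.sum_pair hst]
    · have h2 : ∀ r, ∑ c, (H r c - G r c) = (H r a - G r a) + (H r b - G r b) := by
        intro r
        rw [← Finset.sum_subset (Finset.subset_univ {a, b}), Finset.sum_pair hab]
        intro c _ hc
        simp only [Finset.mem_insert, Finset.mem_singleton] at hc
        rw [hoff r c (by tauto)]; ring
      rw [h2, h2]; ring
    · intro r _ hr
      simp only [Finset.mem_insert, Finset.mem_singleton] at hr
      exact Finset.sum_eq_zero fun c _ => by rw [hoff r c (by tauto)]; ring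
  -- choose the minimum
  obtain ⟨mu, hmu⟩ : ∃ mu : X, ∀ x, ∑ r, ∑ c, M mu r c ^ 2 ≤ ∑ r, ∑ c, M x r c ^ 2 := by
    have hne : (Set.range fun x => (∑ r, ∑ c, M x r c ^ 2).toNat).Nonempty := ⟨_, x0, rfl⟩
    obtain ⟨mu, hm⟩ := Nat.sInf_mem hne
    refine ⟨mu, fun x => ?_⟩
    have h1 : (∑ r, ∑ c, M mu r c ^ 2).toNat ≤ (∑ r, ∑ c, M x r c ^ 2).toNat := by
      exact hm.le.trans (Nat.sInf_le ⟨x, rfl⟩)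
    have h2 : ∀ x, 0 ≤ ∑ r, ∑ c, M x r c ^ 2 := fun x =>
      Finset.sum_nonneg fun r _ => Finset.sum_nonneg fun c _ => sq_nonneg _
    have := h2 mu; have := h2 x
    omega
  refine ⟨mu, ?_⟩
  set dist : X → ℕ := fun x => (∑ r, ∑ c, |M x r c - M mu r c|).toNat with hdist
  have distnn : ∀ x, 0 ≤ ∑ r, ∑ c, |M x r c - M mu r c| := fun x =>
      Finset.sum_nonneg fun r _ => Finset.sum_nonneg fun c _ => abs_nonneg _
  -- main path statement
  have main : ∀ d : ℕ, (∀ d' < d, ∀ x, dist x = d' → ∃ y, Cn x y ∧ M y = M mu) →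
      ∀ l : ℕ, ∀ x, dist x = d → ∀ (s1 : ρ) (c : ℕ → κ) (r : ℕ → ρ), s1 ≠ top →
        M x s1 (c 0) < M mu s1 (c 0) → M mu s1 (c l) < M x s1 (c l) →
        (∀ i < l, M mu (r i) (c i) < M x (r i) (c i) ∧
          M x (r i) (c (i+1)) < M mu (r i) (c (i+1))) → ∃ y, Cn x y ∧ M y = M mu := by
    intro d ihd l
    induction l using Nat.strong_induction_on with
    | _ l ihl =>
    intro x hx s1 c r hs1 h0 hl hstep
    have hlpos : 0 < l := by
      rcases Nat.eq_zero_or_pos l with h | h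
      · subst h; omega
      · exact h
    -- shortcuts
    by_cases hA : ∃ i, 0 < i ∧ i < l ∧ M mu s1 (c i) < M x s1 (c i)
    · obtain ⟨i, hi0, hil, hi⟩ := hA
      exact ihl i hil x hx s1 c r hs1 h0 hi (fun j hj => hstep j (by omega))
    by_cases hB : ∃ i, 0 < i ∧ i < l ∧ M x s1 (c i) < M mu s1 (c i)
    · obtain ⟨i, hi0, hil, hi⟩ := hB
      refine ihl (l - i) (by omega) x hx s1 (fun j => c (j + i)) (fun j => r (j + i)) hs1
        (by simpa using hi) ?_ ?_
      · simp only [Nat.sub_add_cancel hil.le]; exact hl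
      · intro j hj
        have := hstep (j + i) (by omega)
        have e : j + 1 + i = j + i + 1 := by omega
        simp only [e]; exact this
    by_cases hC : ∃ i j, i < j ∧ j < l ∧ r i = r j
    · obtain ⟨i, j, hij, hjl, hr⟩ := hC
      refine ihl (l - (j - i)) (by omega) x hx s1
        (fun t => if t ≤ i then c t else c (t + (j - i)))
        (fun t => if t < i then r t else r (t + (j - i))) hs1 (by simpa using h0) ?_ ?_
      · have e1 : ¬ (l - (j - i) ≤ i) := by omega
        have e2 : l - (j - i) + (j - i) = l := by omega
        simp only [e1, if_false, e2]; exact hl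
      · intro t ht
        rcases lt_trichotomy t i with h | h | h
        · have e1 : t ≤ i := by omega
          have e2 : t + 1 ≤ i := by omega
          simp only [h, e1, e2, if_true]; exact hstep t (by omega)
        · subst h
          have e1 : ¬ (t + 1 ≤ t) := by omega
          have e2 : t + (j - t) = j := by omega
          have e3 : t + 1 + (j - t) = j + 1 := by omega
          simp only [lt_irrefl, le_refl, e1, if_true, if_false, e2, e3]
          exact ⟨hr ▸ (hstep t (by omega)).1, (hstep j (by omega)).2⟩
        · have e1 : ¬ (t ≤ i) := by omega
          have e2 : ¬ (t + 1 ≤ i) := by omega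
          have e4 : ¬ (t < i) := by omega
          have e3 : t + 1 + (j - i) = t + (j - i) + 1 := by omega
          simp only [e1, e2, e4, if_false, e3]
          exact hstep (t + (j - i)) (by omega)
    push Not at hA hB hC
    have hmid : ∀ i, 0 < i → i < l → M x s1 (c i) = M mu s1 (c i) := fun i h1 h2 =>
      le_antisymm (hA i h1 h2) (hB i h1 h2)
    have hrs : ∀ i < l, r i ≠ s1 := by
      intro i hi he
      have := (hstep i hi).1
      rw [he] at this
      rcases Nat.eq_zero_or_pos i with h | h
      · subst h; omega
      · have := hmid i h hi; omega
    have hcap1 : ∀ a, 1 ≤ cap s1 a := by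
      intro a; rw [hcapd, if_neg hs1]; rcases hz a with h | h <;> omega
    -- choose j
    obtain ⟨j, hjl, hj1, hj2, hj3⟩ : ∃ j < l, M x s1 (c j) < cap s1 (c j) ∧
        1 ≤ M x s1 (c (j+1)) ∧ (M x s1 (c j) = 0 ∨ j = 0) := by
      by_cases hz0 : ∃ j < l, M x s1 (c j) = 0
      · have hne : ((Finset.range l).filter fun j => M x s1 (c j) = 0).Nonempty := by
          obtain ⟨j, h1, h2⟩ := hz0
          exact ⟨j, by simp [h1, h2]⟩
        set j := ((Finset.range l).filter fun j => M x s1 (c j) = 0).max' hne with hj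
        have hjm := Finset.max'_mem _ hne
        rw [← hj] at hjm
        simp only [Finset.mem_filter, Finset.mem_range] at hjm
        refine ⟨j, hjm.1, ?_, ?_, Or.inl hjm.2⟩
        · have := hcap1 (c j); omega
        · rcases (show j + 1 = l ∨ j + 1 < l by omega) with h | h
          · rw [h]; have := hM0 mu s1 (c l); omega
          · by_contra hc
            have h3 : M x s1 (c (j+1)) = 0 := by have := hM0 x s1 (c (j+1)); omega
            have := Finset.le_max' ((Finset.range l).filter fun j => M x s1 (c j) = 0) (j+1)
              (by simp [h, h3])
            omega
      · push Not at hz0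
        refine ⟨0, hlpos, ?_, ?_, Or.inr rfl⟩
        · have := hcap mu s1 (c 0); omega
        · rcases (show 0 + 1 = l ∨ 0 + 1 < l by omega) with h | h
          · rw [h]; have := hM0 mu s1 (c l); omega
          · have := hz0 _ h; have := hM0 x s1 (c (0+1)); omega
    obtain ⟨hp, hq⟩ := hstep j hjl
    have hcc : c j ≠ c (j+1) := by intro he; rw [← he] at hq; omega
    have hM0j := hM0 mu (r j) (c j)
    have hcapj := hcap mu (r j) (c (j+1))
    have hcapx := hcap x (r j) (c j)
    obtain ⟨y, hxy, y1, y2, y3, y4, yoff⟩ := real x (r j) s1 (c j) (c (j+1)) (hrs j hjl) hcc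
      (by omega) hj2 (by omega) hj1 (by
        rintro ⟨g1, g2, g3, g4⟩
        have hj0 : j = 0 := by omega
        subst hj0
        have k1 : M mu (r 0) (c 0) = 0 := by omega
        have k2 : M mu s1 (c 0) = 2 := by
          have := hcap mu s1 (c 0)
          rw [hcapd, if_neg hs1] at this
          rcases hz (c 0) with h | h <;> omega
        have hzc : z (c (0+1)) = 0 ∧ r 0 ≠ top := by
          rw [hcapd] at hcapj
          split_ifs at hcapj with hrt
          · rcases hz (c (0+1)) with h | h <;> omega
          · refine ⟨?_, hrt⟩
            rcases hz (c (0+1)) with h | h <;> omega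
        have k3 : M mu (r 0) (c (0+1)) = 2 := by
          rw [hcapd, if_neg hzc.2] at hcapj; omega
        have k4 : M mu s1 (c (0+1)) ≤ 1 := by
          rcases (show 0 + 1 = l ∨ 0 + 1 < l by omega) with h | h
          · rw [h] at g2 ⊢; omega
          · have := hmid (0+1) (by omega) h; omega
        have k5 := hM0 mu s1 (c (0+1))
        obtain ⟨w, -, w1, w2, w3, w4, woff⟩ := real mu s1 (r 0) (c 0) (c (0+1))
          (hrs 0 hjl).symm hcc (by omega) (by omega)
          (by rw [hcapd, if_neg hs1]; omega) (by omega) (by omega)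
        have hw := hmu w
        have h4 := four (fun r c => M mu r c ^ 2) (fun r c => M w r c ^ 2) s1 (r 0) (c 0) (c (0+1))
          (hrs 0 hjl).symm hcc (fun r c h => by simp only [woff r c h])
        simp only [w1, w2, w3, w4, k1, k2, k3] at h4
        nlinarith)
    have hd := four (fun r c => |M x r c - M mu r c|) (fun r c => |M y r c - M mu r c|)
      (r j) s1 (c j) (c (j+1)) (hrs j hjl) hcc (fun r c h => by simp only [yoff r c h])
    simp only [y1, y2, y3, y4] at hd
    have a1 : |M x (r j) (c j) - 1 - M mu (r j) (c j)| - |M x (r j) (c j) - M mu (r j) (c j)| = -1 := by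
      rw [abs_of_nonneg (by omega), abs_of_nonneg (by omega)]; ring
    have a2 : |M x (r j) (c (j+1)) + 1 - M mu (r j) (c (j+1))|
        - |M x (r j) (c (j+1)) - M mu (r j) (c (j+1))| = -1 := by
      rw [abs_of_nonpos (by omega), abs_of_nonpos (by omega)]; ring
    have a3 : |M x s1 (c j) + 1 - M mu s1 (c j)| - |M x s1 (c j) - M mu s1 (c j)|
        = if j = 0 then -1 else 1 := by
      split_ifs with h
      · subst h; rw [abs_of_nonpos (by omega), abs_of_nonpos (by omega)]; ring
      · rw [hmid j (by omega) hjl]; simp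
    have a4 : |M x s1 (c (j+1)) - 1 - M mu s1 (c (j+1))| - |M x s1 (c (j+1)) - M mu s1 (c (j+1))|
        = if j + 1 = l then -1 else 1 := by
      split_ifs with h
      · rw [h]; rw [abs_of_nonneg (by omega), abs_of_nonneg (by omega)]; ring
      · rw [hmid (j+1) (by omega) (by omega)]; simp
    rw [a1, a2, a3, a4] at hd
    have dx := distnn x
    have dy := distnn y
    have hxd : dist x = (∑ r, ∑ c, |M x r c - M mu r c|).toNat := rfl
    have hyd : dist y = (∑ r, ∑ c, |M y r c - M mu r c|).toNat := rfl
    by_cases hcase : j = 0 ∨ j + 1 = l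
    · have hlt : dist y < d := by
        rw [← hx, hyd, hxd]
        rcases hcase with h | h
        · rw [if_pos h] at hd; split_ifs at hd <;> omega
        · rw [if_pos h] at hd; split_ifs at hd <;> omega
      obtain ⟨w, hw1, hw2⟩ := ihd _ hlt y rfl
      exact ⟨w, htrans _ _ _ hxy hw1, hw2⟩
    · push Not at hcase
      have hyx : dist y = d := by
        rw [← hx, hyd, hxd]
        rw [if_neg hcase.1, if_neg hcase.2] at hd
        omega
      have hoff0 : M y s1 (c 0) = M x s1 (c 0) := by
        apply yoff
        rintro ⟨-, h | h⟩
        · have := hmid j (by omega) hjl; rw [← h] at this; omega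
        · have := hmid (j+1) (by omega) (by omega); rw [← h] at this; omega
      obtain ⟨w, hw1, hw2⟩ := ihl j hjl y hyx s1 c r hs1 (by omega)
        (by have := hmid j (by omega) hjl; omega) (by
          intro i hi
          have hne1 := hC i j hi hjl
          have hne2 := hrs i (by omega)
          rw [yoff (r i) (c i) (by tauto), yoff (r i) (c (i+1)) (by tauto)]
          exact hstep i (by omega))
      exact ⟨w, htrans _ _ _ hxy hw1, hw2⟩
  -- conclude
  have fin : ∀ d : ℕ, ∀ x, dist x = d → ∃ y, Cn x y ∧ M y = M mu := by
    intro d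
    induction d using Nat.strong_induction_on with
    | _ d ihd =>
    intro x hx
    by_cases heq : M x = M mu
    · exact ⟨x, hrefl x, heq⟩
    have hDcol : ∀ a, ∑ s, (M x s a - M mu s a) = 0 := fun a => by
      rw [Finset.sum_sub_distrib, hcol x mu a, sub_self]
    have hDrow : ∀ s, ∑ a, (M x s a - M mu s a) = 0 := fun s => by
      rw [Finset.sum_sub_distrib, hrow x mu s, sub_self]
    obtain ⟨s1, hs1, a, ha⟩ : ∃ s1, s1 ≠ top ∧ ∃ a, M x s1 a - M mu s1 a ≠ 0 := by
      by_contra hcon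
      push Not at hcon
      apply heq
      funext s a
      by_cases hs : s = top
      · have := hDcol a
        rw [Finset.sum_eq_single top (fun b _ hb => hcon b hb a) (by simp)] at this
        rw [hs]; omega
      · have := hcon s hs a; omega
    obtain ⟨a2, ha2⟩ : ∃ a2, M x s1 a2 - M mu s1 a2 < 0 := by
      by_contra hcon
      push Not at hcon
      exact ha ((Finset.sum_eq_zero_iff_of_nonneg (fun b _ => hcon b)).1 (hDrow s1) a (Finset.mem_univ _))
    obtain ⟨a1, h1, hpath⟩ := bal_path (fun s a => M x s a - M mu s a) hDrow hDcol s1 a2 ha2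
    have : Nonempty ρ := ⟨top⟩
    obtain ⟨l, c, r, e1, e2, hst⟩ := rtg_path _ _ _ hpath
    refine main d ihd l x hx s1 c r hs1 ?_ ?_ ?_
    · rw [e1]; omega
    · rw [e2]; omega
    · intro i hi
      have := hst i hi
      omega
  exact fun x => fin _ x rfl



/-- combinatorial segment number -/
noncomputable def segf {n : ℕ} (I : Finset (Fin n)) (i : Fin n) : ℕ :=
  ((Finset.univ \ I).filter (fun j => j < i)).card + 1

theorem mval_eq {n : ℕ} (I : Finset (Fin n)) : mval n I = (Finset.univ \ I).card + 1 := by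
  simp [mval, Qlist]

theorem segf_pos {n : ℕ} (I : Finset (Fin n)) (i : Fin n) : 1 ≤ segf I i := by
  simp [segf]

theorem segf_le {n : ℕ} (I : Finset (Fin n)) (i : Fin n) : segf I i ≤ mval n I := by
  rw [mval_eq, segf]
  exact Nat.succ_le_succ (Finset.card_filter_le _ _)

theorem sorted_count {n : ℕ} (i : Fin n) : ∀ (L : List (Fin n)), L.Pairwise (· < ·) →
    ∀ k, (h : k < L.length) → (L[k] < i ↔ k < L.countP (fun j => decide (j < i))) := by
  intro L
  induction L with
  | nil => intro _ k h; simp at h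
  | cons a L ih =>
    intro hs k h
    rw [List.pairwise_cons] at hs
    by_cases ha : a < i
    · rw [List.countP_cons_of_pos (by simpa using ha)]
      rcases k with _ | k
      · simp [ha]
      · simp only [List.getElem_cons_succ]
        rw [ih hs.2 k (by simpa using h)]; omega
    · have h0 : (a :: L).countP (fun j => decide (j < i)) = 0 := by
        rw [List.countP_eq_zero]
        intro b hb
        rcases List.mem_cons.1 hb with h | h
        · subst h; simpa using ha
        · have := hs.1 b h
          simp only [decide_eq_true_eq, not_lt]; exact (not_lt.1 ha).trans this.le
      rw [h0]
      rcases k with _ | k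
      · simpa using ha
      · have : a < (a :: L)[k+1] := hs.1 _ (by simp)
        constructor
        · intro h'; exact absurd (this.trans h') ha
        · omega

theorem qv_eq {n : ℕ} {ct : CType} (hct : ct = CType.B ∨ ct = CType.C) (I : Finset (Fin n)) (s : ℕ) :
    qv n ct I s = qval n I s := by
  have : StandardI n ct I := by
    intro h; rcases hct with h' | h' <;> rw [h'] at h <;> cases h
  simp [qv, this]

theorem inSeg_iff {n : ℕ} {ct : CType} (hct : ct = CType.B ∨ ct = CType.C) (I : Finset (Fin n))
    (s : ℕ) (i : Fin n) (h1 : 1 ≤ s) (h2 : s ≤ mval n I) :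
    InSeg n ct I s i ↔ segf I i = s := by
  set L := (Finset.univ \ I).sort (· ≤ ·) with hL
  have hlen : L.length = (Finset.univ \ I).card := by simp [hL]
  have hm : mval n I = L.length + 1 := by rw [mval_eq, hlen]
  have hcnt : segf I i = L.countP (fun j => decide (j < i)) + 1 := by
    rw [segf, List.countP_eq_length_filter, ← List.toFinset_card_of_nodup]
    · congr 2
      ext j; simp [hL]
    · exact List.Nodup.filter _ (Finset.sort_nodup _ _)
  have hsort : L.Pairwise (· < ·) := (Finset.sortedLT_sort _).pairwise
  have hq : ∀ t, (ht : t < L.length) → qval n I (t+1) = (L[t]).1 + 1 := by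
    intro t ht
    simp only [qval, hm]
    rw [if_neg (by omega), if_pos (by omega)]
    simp [Qlist, ← hL, ht]
  have key := sorted_count i L hsort
  have hle := segf_le I i
  unfold InSeg
  rw [qv_eq hct, qv_eq hct]
  have hi := i.2
  have lower : qval n I (s - 1) < i.1 + 1 ↔ s - 1 ≤ L.countP (fun j => decide (j < i)) := by
    rcases (show s = 1 ∨ 2 ≤ s by omega) with h | h
    · subst h; simp [qval]
    · obtain ⟨t, rfl⟩ : ∃ t, s = t + 2 := ⟨s - 2, by omega⟩
      have := key t (by omega)
      rw [show t + 2 - 1 = t + 1 by omega, hq t (by omega)]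
      rw [Fin.lt_def] at this
      omega
  have upper : i.1 + 1 ≤ qval n I s ↔ L.countP (fun j => decide (j < i)) ≤ s - 1 := by
    rcases (show s = mval n I ∨ s < mval n I by omega) with h | h
    · have : qval n I s = n := by
        simp only [qval]; rw [if_neg (by omega), if_neg (by omega)]
      rw [this]; omega
    · obtain ⟨t, rfl⟩ : ∃ t, s = t + 1 := ⟨s - 1, by omega⟩
      have := key t (by omega)
      rw [hq t (by omega)]
      rw [Fin.lt_def] at this
      omega
  rw [lower, upper]
  omega

theorem segf_eq_iff {n : ℕ} (I : Finset (Fin n)) (i j : Fin n) (h : i ≤ j) :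
    segf I i = segf I j ↔ ∀ k, i ≤ k → k < j → k ∈ I := by
  unfold segf
  have hsub : (Finset.univ \ I).filter (fun k => k < i) ⊆ (Finset.univ \ I).filter (fun k => k < j) := by
    intro k; simp only [Finset.mem_filter]; exact fun hk => ⟨hk.1, hk.2.trans_le h⟩
  constructor
  · intro he k h1 h2
    by_contra hk
    have := Finset.eq_of_subset_of_card_le hsub (by omega)
    have hk2 : k ∈ (Finset.univ \ I).filter (fun k => k < j) := by simp [hk, h2]
    rw [← this] at hk2
    exact absurd (Finset.mem_filter.1 hk2).2 (not_lt.2 h1)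
  · intro hk
    congr 2
    ext k
    simp only [Finset.mem_filter, Finset.mem_sdiff, Finset.mem_univ, true_and]
    constructor
    · exact fun h' => ⟨h'.1, h'.2.trans_le h⟩
    · exact fun h' => ⟨h'.1, by by_contra hc; exact h'.1 (hk k (not_lt.1 hc) h'.2)⟩

theorem segf_top_iff {n : ℕ} (I : Finset (Fin n)) (i : Fin n) :
    segf I i = mval n I ↔ ∀ k, i ≤ k → k ∈ I := by
  rw [mval_eq]; unfold segf
  constructor
  · intro he k h1
    by_contra hk
    have := Finset.eq_of_subset_of_card_le (Finset.filter_subset (fun k => k < i) (Finset.univ \ I)) (by omega)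
    have hk2 : k ∈ (Finset.univ \ I) := by simp [hk]
    rw [← this] at hk2
    exact absurd (Finset.mem_filter.1 hk2).2 (not_lt.2 h1)
  · intro hk
    rw [Finset.filter_true_of_mem]
    intro k hk'
    by_contra hc
    simp only [Finset.mem_sdiff, Finset.mem_univ, true_and] at hk'
    exact hk' (hk k (not_lt.1 hc))

theorem seg_exists {n : ℕ} (I : Finset (Fin n)) (s : ℕ) (h1 : 1 ≤ s) (h2 : s < mval n I) :
    ∃ i, segf I i = s := by
  set L := (Finset.univ \ I).sort (· ≤ ·) with hL
  have hlen : L.length = (Finset.univ \ I).card := by simp [hL]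
  rw [mval_eq, ← hlen] at h2
  refine ⟨L[s-1], ?_⟩
  have hsort : L.Pairwise (· < ·) := (Finset.sortedLT_sort _).pairwise
  have key := sorted_count (L[s-1]) L hsort
  have hcnt' : ∀ i, segf I i = L.countP (fun j => decide (j < i)) + 1 := by
    intro i
    rw [segf, List.countP_eq_length_filter, ← List.toFinset_card_of_nodup]
    · congr 2
      ext j; simp [hL]
    · exact List.Nodup.filter _ (Finset.sort_nodup _ _)
  have hcnt := hcnt' L[s-1]
  have k1 := key (s-1) (by omega)
  simp only [lt_irrefl, false_iff, not_lt] at k1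
  rcases (show s = 1 ∨ 2 ≤ s by omega) with h | h
  · subst h; simp only [Nat.sub_self] at *; omega
  · have k2 := (key (s-2) (by omega)).1 (List.pairwise_iff_getElem.1 hsort _ _ _ _ (by omega))
    omega

/-- combinatorial regularity -/
def Rg {n : ℕ} (I : Finset (Fin n)) (x : V n) : Prop :=
  (∀ i j, i ≠ j → segf I i = segf I j → x i ≠ x j) ∧
  (∀ i, segf I i = mval n I → x i ≠ 0) ∧
  (∀ i j, i ≠ j → segf I i = mval n I → segf I j = mval n I → x i ≠ - x j)

theorem inn_ee {n : ℕ} (x : V n) (i : Fin n) : inn x (ee i) = x i := by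
  simp [inn, ee, Pi.single_apply]

theorem inn_add {n : ℕ} (x v w : V n) : inn x (v + w) = inn x v + inn x w := by
  simp [inn, mul_add, Finset.sum_add_distrib]
theorem inn_sub {n : ℕ} (x v w : V n) : inn x (v - w) = inn x v - inn x w := by
  simp [inn, mul_sub, Finset.sum_sub_distrib]
theorem inn_neg {n : ℕ} (x v : V n) : inn x (- v) = - inn x v := by
  simp [inn]
theorem inn_smul {n : ℕ} (x v : V n) (c : ℝ) : inn x (c • v) = c * inn x v := by
  simp [inn, Finset.mul_sum]; exact Finset.sum_congr rfl fun _ _ => by ring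

/-- the short or long root -/
noncomputable def sr {n : ℕ} (ct : CType) (i : Fin n) : V n := if ct = CType.B then ee i else (2:ℝ) • ee i

theorem sr_mem {n : ℕ} {ct : CType} (hct : ct = CType.B ∨ ct = CType.C) (i : Fin n) : sr ct i ∈ Phi n ct := by
  rcases hct with rfl | rfl
  · exact Or.inr ⟨i, Or.inl (by simp [sr])⟩
  · exact Or.inr ⟨i, Or.inl (by simp [sr])⟩

theorem D_mem {n : ℕ} {ct : CType} (v : V n) (h : v ∈ DRoots n) : v ∈ Phi n ct := by
  cases ct
  · exact Or.inl h
  · exact Or.inl h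
  · exact h

theorem alpha_lt {n : ℕ} (ct : CType) (i : Fin n) (h : i.1 + 1 < n) :
    alphaR n ct i = ee i - ee ⟨i.1 + 1, h⟩ := by simp [alphaR, h]

theorem alpha_last {n : ℕ} {ct : CType} (hct : ct = CType.B ∨ ct = CType.C) (i : Fin n) (h : ¬ i.1 + 1 < n) :
    alphaR n ct i = sr ct i := by
  rcases hct with rfl | rfl <;> simp [alphaR, h, sr]

theorem span_sub {n : ℕ} (ct : CType) (I : Finset (Fin n)) :
    ∀ d : ℕ, ∀ i j : Fin n, i.1 + d = j.1 → segf I i = segf I j →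
    ee i - ee j ∈ Submodule.span ℝ (alphaR n ct '' (I : Set (Fin n))) := by
  intro d
  induction d with
  | zero => intro i j h _; have : i = j := Fin.ext (by omega)
            subst this; simp
  | succ d ih =>
    intro i j h hs
    have hj := j.2
    have hij : i ≤ j := Fin.le_def.2 (by omega)
    rw [segf_eq_iff I i j hij] at hs
    set k : Fin n := ⟨i.1 + d, by omega⟩ with hk
    have hik : i ≤ k := Fin.le_def.2 (by simp [hk])
    have hkj : k < j := Fin.lt_def.2 (by simp [hk]; omega)
    have h1 := ih i k rfl ((segf_eq_iff I i k hik).2 fun l h1 h2 => hs l h1 (h2.trans hkj))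
    have h2 : alphaR n ct k ∈ Submodule.span ℝ (alphaR n ct '' (I : Set (Fin n))) :=
      Submodule.subset_span ⟨k, hs k hik hkj, rfl⟩
    have hkn : k.1 + 1 < n := by simp only [hk]; omega
    rw [alpha_lt ct k hkn] at h2
    have : (⟨k.1 + 1, hkn⟩ : Fin n) = j := Fin.ext (by simp only [hk]; omega)
    rw [this] at h2
    have := Submodule.add_mem _ h1 h2
    simpa using this

theorem span_ee {n : ℕ} {ct : CType} (hct : ct = CType.B ∨ ct = CType.C) (I : Finset (Fin n)) (i : Fin n)
    (h : segf I i = mval n I) : ee i ∈ Submodule.span ℝ (alphaR n ct '' (I : Set (Fin n))) := by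
  have hn := i.2
  set k : Fin n := ⟨n - 1, by omega⟩ with hk
  have hik : i ≤ k := Fin.le_def.2 (by simp only [hk]; omega)
  have ht := (segf_top_iff I i).1 h
  have h1 := span_sub ct I (n - 1 - i.1) i k (by simp only [hk]; omega)
    ((segf_eq_iff I i k hik).2 fun l h1 _ => ht l h1)
  have h2 : alphaR n ct k ∈ Submodule.span ℝ (alphaR n ct '' (I : Set (Fin n))) :=
      Submodule.subset_span ⟨k, ht k hik, rfl⟩
  rw [alpha_last hct k (by simp only [hk]; omega)] at h2
  have h3 : ee k ∈ Submodule.span ℝ (alphaR n ct '' (I : Set (Fin n))) := by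
    rcases hct with rfl | rfl
    · simpa [sr] using h2
    · have := Submodule.smul_mem _ (1/2 : ℝ) h2
      simpa [sr, smul_smul] using this
  simpa using Submodule.add_mem _ h1 h3

theorem span_zero {n : ℕ} {ct : CType} (hct : ct = CType.B ∨ ct = CType.C) (I : Finset (Fin n)) (v : V n)
    (hv : v ∈ Submodule.span ℝ (alphaR n ct '' (I : Set (Fin n)))) (q : Fin n) (hq : q ∉ I) :
    ∑ i ∈ Finset.univ.filter (fun i => i ≤ q), v i = 0 := by
  induction hv using Submodule.span_induction with
  | mem x hx =>
    obtain ⟨k, hk, rfl⟩ := hx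
    have hkq : k ≠ q := fun h => hq (h ▸ hk)
    by_cases h : k.1 + 1 < n
    · rw [alpha_lt ct k h]
      simp only [ee, Pi.sub_apply, Finset.sum_sub_distrib, Pi.single_apply, Finset.sum_ite_eq',
        Finset.mem_filter, Finset.mem_univ, true_and]
      have : k ≤ q ↔ (⟨k.1+1, h⟩ : Fin n) ≤ q := by
        simp only [Fin.le_def]
        have : k.1 ≠ q.1 := fun h => hkq (Fin.ext h)
        omega
      simp [this]
    · rw [alpha_last hct k h]
      have hq2 := q.2
      have : ¬ k ≤ q := by
        have : k.1 ≠ q.1 := fun h => hkq (Fin.ext h)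
        rw [Fin.le_def]; omega
      apply Finset.sum_eq_zero
      intro i hi
      have hik : i ≠ k := by rintro rfl; exact this (Finset.mem_filter.1 hi).2
      unfold sr; split_ifs <;> simp [ee, hik]
  | zero => simp
  | add x y _ _ hx hy => simp [Finset.sum_add_distrib, hx, hy]
  | smul c x _ hx => simp [← Finset.mul_sum, hx]

theorem not_seg {n : ℕ} {ct : CType} (hct : ct = CType.B ∨ ct = CType.C) (I : Finset (Fin n)) (i j : Fin n)
    (hij : i < j) (h : ee i - ee j ∈ Submodule.span ℝ (alphaR n ct '' (I : Set (Fin n)))) :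
    segf I i = segf I j := by
  rw [segf_eq_iff I i j hij.le]
  intro k h1 h2
  by_contra hk
  have := span_zero hct I _ h k hk
  simp only [ee, Pi.sub_apply, Finset.sum_sub_distrib, Pi.single_apply, Finset.sum_ite_eq',
        Finset.mem_filter, Finset.mem_univ, true_and, h1, not_le.2 h2] at this
  norm_num at this

theorem not_seg_top {n : ℕ} {ct : CType} (hct : ct = CType.B ∨ ct = CType.C) (I : Finset (Fin n)) (i : Fin n)
    (v : V n) (h0 : ∀ k, 0 ≤ v k) (hi : 0 < v i)
    (h : v ∈ Submodule.span ℝ (alphaR n ct '' (I : Set (Fin n)))) :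
    segf I i = mval n I := by
  rw [segf_top_iff]
  intro k h1
  by_contra hk
  have := span_zero hct I _ h k hk
  rw [Finset.sum_eq_zero_iff_of_nonneg (fun k _ => h0 k)] at this
  have := this i (by simp [h1])
  linarith

theorem ee_nonneg {n : ℕ} (i k : Fin n) : 0 ≤ (ee i : V n) k := by
  simp only [ee, Pi.single_apply]; split_ifs <;> norm_num

theorem ee_self {n : ℕ} (i : Fin n) : (ee i : V n) i = 1 := by simp [ee]

theorem regI_iff {n : ℕ} {ct : CType} (hct : ct = CType.B ∨ ct = CType.C) (I : Finset (Fin n)) (x : V n) :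
    RegI n ct I x ↔ Rg I x := by
  constructor
  · intro h
    refine ⟨?_, ?_, ?_⟩
    · have aux : ∀ i j, i < j → segf I i = segf I j → x i ≠ x j := by
        intro i j hij hs he
        refine h (ee i - ee j) ⟨D_mem _ ⟨i, j, hij.ne, Or.inr (Or.inl rfl)⟩,
          span_sub ct I (j.1 - i.1) i j (by have := Fin.lt_def.1 hij; omega) hs⟩ ?_
        rw [inn_sub, inn_ee, inn_ee, he, sub_self]
      intro i j hij hs
      rcases lt_or_gt_of_ne hij with h | h
      · exact aux i j h hs
      · exact (aux j i h hs.symm).symm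
    · intro i hi he
      refine h (sr ct i) ⟨sr_mem hct i, ?_⟩ ?_
      · have := span_ee hct I i hi
        unfold sr; split_ifs
        · exact this
        · exact Submodule.smul_mem _ _ this
      · unfold sr; split_ifs <;> simp [inn_smul, inn_ee, he]
    · intro i j hij hi hj he
      refine h (ee i + ee j) ⟨D_mem _ ⟨i, j, hij, Or.inl rfl⟩,
        Submodule.add_mem _ (span_ee hct I i hi) (span_ee hct I j hj)⟩ ?_
      rw [inn_add, inn_ee, inn_ee, he]; ring
  · rintro ⟨h1, h2, h3⟩ β ⟨hβ, hsp⟩ h0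
    have top : ∀ i j, ee i + ee j ∈ Submodule.span ℝ (alphaR n ct '' (I : Set (Fin n))) →
        segf I i = mval n I ∧ segf I j = mval n I := by
      intro i j h
      have hnn : ∀ k, 0 ≤ (ee i + ee j : V n) k := fun k => add_nonneg (ee_nonneg i k) (ee_nonneg j k)
      constructor
      · refine not_seg_top hct I i _ hnn ?_ h
        have := ee_nonneg j i; simp only [Pi.add_apply, ee_self]; linarith
      · refine not_seg_top hct I j _ hnn ?_ h
        have := ee_nonneg i j; simp only [Pi.add_apply, ee_self]; linarith
    have short : ∀ i, ee i ∈ Submodule.span ℝ (alphaR n ct '' (I : Set (Fin n))) →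
        segf I i = mval n I := by
      intro i h
      exact not_seg_top hct I i _ (ee_nonneg i) (by rw [ee_self]; norm_num) h
    have hD : β ∉ DRoots n := by
      rintro ⟨i, j, hij, rfl | rfl | rfl⟩
      · obtain ⟨hi, hj⟩ := top i j hsp
        rw [inn_add, inn_ee, inn_ee] at h0
        exact h3 i j hij hi hj (by linarith)
      · rw [inn_sub, inn_ee, inn_ee] at h0
        refine h1 i j hij ?_ (by linarith)
        rcases lt_or_gt_of_ne hij with h | h
        · exact not_seg hct I i j h hsp
        · refine (not_seg hct I j i h ?_).symm
          have := Submodule.neg_mem _ hsp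
          simpa using this
      · obtain ⟨hi, hj⟩ := top i j (by
          have := Submodule.neg_mem _ hsp
          convert this using 1; abel)
        rw [inn_sub, inn_neg, inn_ee, inn_ee] at h0
        exact h3 i j hij hi hj (by linarith)
    rcases hct with rfl | rfl
    · rcases hβ with h | ⟨i, rfl | rfl⟩
      · exact hD h
      · rw [inn_ee] at h0; exact h2 i (short i hsp) h0
      · rw [inn_neg, inn_ee] at h0
        exact h2 i (short i (by simpa using Submodule.neg_mem _ hsp)) (by linarith)
    · rcases hβ with h | ⟨i, rfl | rfl⟩
      · exact hD h
      · rw [inn_smul, inn_ee] at h0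
        refine h2 i (short i ?_) (by linarith)
        have := Submodule.smul_mem _ (1/2:ℝ) hsp
        simpa [smul_smul] using this
      · rw [inn_neg, inn_smul, inn_ee] at h0
        refine h2 i (short i ?_) (by linarith)
        have := Submodule.smul_mem _ (-1/2:ℝ) hsp
        simpa [smul_smul] using this



/-- negated swap -/
noncomputable def nsw {n : ℕ} (x : V n) (i j : Fin n) : V n :=
  fun k => if k = i then - x j else if k = j then - x i else x k

theorem nsw_comm {n : ℕ} (x : V n) (i j : Fin n) : nsw x i j = nsw x j i := by
  funext k; unfold nsw; split_ifs <;> simp_all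

theorem sRefl_sub {n : ℕ} (x : V n) (i j : Fin n) (h : i ≠ j) :
    sRefl (ee i - ee j) x = x ∘ Equiv.swap i j := by
  have h1 : inn (ee i - ee j : V n) (ee i - ee j) = 2 := by
    rw [inn_sub, inn_ee, inn_ee]; simp [ee, h, h.symm]; norm_num
  funext k
  simp only [sRefl, h1, inn_sub, inn_ee, Pi.sub_apply, Pi.smul_apply, smul_eq_mul, Function.comp]
  by_cases hi : k = i
  · subst hi; simp [ee, h]
  · by_cases hj : k = j
    · subst hj; simp [ee, hi]
    · rw [Equiv.swap_apply_of_ne_of_ne hi hj]; simp [ee, hi, hj]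

theorem sRefl_add {n : ℕ} (x : V n) (i j : Fin n) (h : i ≠ j) :
    sRefl (ee i + ee j) x = nsw x i j := by
  have h1 : inn (ee i + ee j : V n) (ee i + ee j) = 2 := by
    rw [inn_add, inn_ee, inn_ee]; simp [ee, h, h.symm]; norm_num
  funext k
  simp only [sRefl, h1, inn_add, inn_ee, Pi.sub_apply, Pi.smul_apply, smul_eq_mul, Pi.add_apply, nsw]
  by_cases hi : k = i
  · subst hi; simp [ee, h]
  · by_cases hj : k = j
    · subst hj; simp [ee, hi]
    · simp [ee, hi, hj]

theorem sRefl_ee {n : ℕ} (x : V n) (i : Fin n) :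
    sRefl (ee i) x = Function.update x i (- x i) := by
  funext k
  simp only [sRefl, inn_ee, Pi.sub_apply, Pi.smul_apply, smul_eq_mul, ee_self]
  by_cases hi : k = i
  · subst hi; simp [ee]; ring
  · simp [ee, hi]

theorem sRefl_sr {n : ℕ} (ct : CType) (x : V n) (i : Fin n) :
    sRefl (sr ct i) x = Function.update x i (- x i) := by
  unfold sr; split_ifs
  · exact sRefl_ee x i
  · rw [← sRefl_ee]
    funext k
    simp only [sRefl, inn_smul, inn_ee, Pi.sub_apply, Pi.smul_apply, smul_eq_mul, ee_self]
    ring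

theorem wi_swap_lt {n : ℕ} (ct : CType) (I : Finset (Fin n)) :
    ∀ d : ℕ, ∀ (x : V n) (i j : Fin n), i.1 + d = j.1 → segf I i = segf I j →
    WIOrb n ct I x (x ∘ Equiv.swap i j) := by
  intro d
  induction d with
  | zero => intro x i j h _; have : i = j := Fin.ext (by omega)
            subst this; simp only [Equiv.swap_self]; exact Relation.ReflTransGen.refl
  | succ d ih =>
    intro x i j h hs
    have hj := j.2
    have hij : i ≤ j := Fin.le_def.2 (by omega)
    rw [segf_eq_iff I i j hij] at hs
    set k : Fin n := ⟨i.1 + d, by omega⟩ with hk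
    have hik : i ≤ k := Fin.le_def.2 (by simp [hk])
    have hkj : k < j := Fin.lt_def.2 (by simp [hk]; omega)
    have hsk := ((segf_eq_iff I i k hik).2 fun l h1 h2 => hs l h1 (h2.trans hkj))
    have hkn : k.1 + 1 < n := by simp only [hk]; omega
    have hkj' : (⟨k.1 + 1, hkn⟩ : Fin n) = j := Fin.ext (by simp only [hk]; omega)
    have step : ∀ y : V n, WIOrb n ct I y (y ∘ Equiv.swap k j) := by
      intro y
      refine Relation.ReflTransGen.single ⟨k, hs k hik hkj, ?_⟩
      rw [alpha_lt ct k hkn, hkj', sRefl_sub _ _ _ hkj.ne]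
    have h1 := ih x i k rfl hsk
    have h2 := step (x ∘ Equiv.swap i k)
    have h3 := ih ((x ∘ Equiv.swap i k) ∘ Equiv.swap k j) i k rfl hsk
    have h4 := (h1.trans h2).trans h3
    have e : ((x ∘ Equiv.swap i k) ∘ Equiv.swap k j) ∘ Equiv.swap i k = x ∘ Equiv.swap i j := by
      funext l
      have hij' : i ≠ j := (hik.trans_lt hkj).ne
      have hkj2 : k ≠ j := hkj.ne
      clear_value k
      simp only [Function.comp]
      congr 1
      clear h4 h3 h2 h1 step hkj' hsk hs ih
      by_cases hik2 : i = k
      · subst hik2; simp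
      by_cases l1 : l = i
      · subst l1; simp [Equiv.swap_apply_of_ne_of_ne hij'.symm hkj2.symm]
      by_cases l2 : l = k
      · subst l2; simp [Equiv.swap_apply_of_ne_of_ne l1 hkj2, Equiv.swap_apply_of_ne_of_ne hik2 hij']
      by_cases l3 : l = j
      · subst l3; simp [Equiv.swap_apply_of_ne_of_ne l1 l2]
      rw [Equiv.swap_apply_of_ne_of_ne l1 l2, Equiv.swap_apply_of_ne_of_ne l2 l3, Equiv.swap_apply_of_ne_of_ne l1 l2, Equiv.swap_apply_of_ne_of_ne l1 l3]
    rw [e] at h4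
    exact h4

theorem wi_swap {n : ℕ} (ct : CType) (I : Finset (Fin n)) (x : V n) (i j : Fin n)
    (hs : segf I i = segf I j) : WIOrb n ct I x (x ∘ Equiv.swap i j) := by
  rcases le_total i j with h | h
  · exact wi_swap_lt ct I (j.1 - i.1) x i j (by have := Fin.le_def.1 h; omega) hs
  · rw [Equiv.swap_comm]
    exact wi_swap_lt ct I (i.1 - j.1) x j i (by have := Fin.le_def.1 h; omega) hs.symm

theorem wi_flip {n : ℕ} {ct : CType} (hct : ct = CType.B ∨ ct = CType.C) (I : Finset (Fin n)) (x : V n)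
    (i : Fin n) (hs : segf I i = mval n I) : WIOrb n ct I x (Function.update x i (- x i)) := by
  have hn := i.2
  set k : Fin n := ⟨n - 1, by omega⟩ with hk
  have hik : i ≤ k := Fin.le_def.2 (by simp only [hk]; omega)
  have ht := (segf_top_iff I i).1 hs
  have hsk := (segf_eq_iff I i k hik).2 fun l h1 _ => ht l h1
  have step : ∀ y : V n, WIOrb n ct I y (Function.update y k (- y k)) := by
    intro y
    refine Relation.ReflTransGen.single ⟨k, ht k hik, ?_⟩
    rw [alpha_last hct k (by simp only [hk]; omega), sRefl_sr]
  have h4 := ((wi_swap ct I x i k hsk).trans (step _)).trans (wi_swap ct I _ i k hsk)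
  suffices e : Function.update x i (- x i) = (Function.update (x ∘ Equiv.swap i k) k (- (x ∘ Equiv.swap i k) k)) ∘ Equiv.swap i k by
    rw [e]; exact h4
  funext l
  simp only [Function.comp, Function.update_apply, Equiv.swap_apply_right]
  by_cases hl : l = i
  · subst hl; simp
  · by_cases hl2 : l = k
    · subst hl2; simp [hl]; intro h; exact absurd h.symm hl
    · rw [Equiv.swap_apply_of_ne_of_ne hl hl2]; simp [hl, hl2, Equiv.swap_apply_of_ne_of_ne hl hl2]

theorem conn_refl {n : ℕ} {ct : CType} (hct : ct = CType.B ∨ ct = CType.C) {I : Finset (Fin n)} {x : V n}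
    (h : Rg I x) : Conn n ct I x x :=
  ⟨(regI_iff hct I x).2 h, (regI_iff hct I x).2 h, Relation.ReflTransGen.refl⟩

theorem conn_trans {n : ℕ} {ct : CType} {I : Finset (Fin n)} {x y w : V n}
    (h1 : Conn n ct I x y) (h2 : Conn n ct I y w) : Conn n ct I x w :=
  ⟨h1.1, h2.2.1, h1.2.2.trans h2.2.2⟩

theorem conn_wi {n : ℕ} {ct : CType} (hct : ct = CType.B ∨ ct = CType.C) {I : Finset (Fin n)} {x y : V n}
    (hx : Rg I x) (hy : Rg I y) (h : WIOrb n ct I x y) : Conn n ct I x y := by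
  rw [← regI_iff hct] at hx hy
  exact ⟨hx, hy, Relation.ReflTransGen.single ⟨hx, hy, Or.inl h⟩⟩

theorem conn_root {n : ℕ} {ct : CType} (hct : ct = CType.B ∨ ct = CType.C) {I : Finset (Fin n)} {x : V n}
    (β : V n) (hx : Rg I x) (hy : Rg I (sRefl β x)) (hβ : β ∈ PhiPos n ct) (hβI : β ∉ PhiI n ct I)
    (hexc : ¬ ExcBC n ct I (sr ct) x β) : Conn n ct I x (sRefl β x) := by
  by_cases he : sRefl β x = x
  · rw [he]; exact conn_refl hct hx
  rw [← regI_iff hct] at hx hy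
  have hst : StandardI n ct I := by
    intro h; rcases hct with h' | h' <;> rw [h'] at h <;> cases h
  refine ⟨hx, hy, Relation.ReflTransGen.single ⟨hx, hy, Or.inr ⟨β, ?_, Relation.ReflTransGen.refl⟩⟩⟩
  rw [LinkedRoot, if_pos hst]
  refine ⟨hx, hβ, hβI, hy, he, ?_⟩
  intro h
  apply hexc
  rcases hct with rfl | rfl
  · exact h
  · exact h

theorem sr_nonneg {n : ℕ} (ct : CType) (i k : Fin n) : 0 ≤ (sr ct i : V n) k := by
  unfold sr; split_ifs
  · exact ee_nonneg i k
  · have := ee_nonneg i k; simp only [Pi.smul_apply, smul_eq_mul]; linarith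

theorem ee_ne {n : ℕ} {i k : Fin n} (h : k ≠ i) : (ee i : V n) k = 0 := by simp [ee, h]

theorem sr_ne {n : ℕ} (ct : CType) {i k : Fin n} (h : k ≠ i) : (sr ct i : V n) k = 0 := by
  unfold sr; split_ifs <;> simp [ee, h]

theorem conn_swap_lt {n : ℕ} {ct : CType} (hct : ct = CType.B ∨ ct = CType.C) {I : Finset (Fin n)} {x : V n}
    {i j : Fin n} (hij : i < j) (hs : segf I i ≠ segf I j)
    (hm : segf I j ≠ mval n I ∨ |x i| ≠ |x j|)
    (hx : Rg I x) (hy : Rg I (x ∘ Equiv.swap i j)) : Conn n ct I x (x ∘ Equiv.swap i j) := by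
  rw [← sRefl_sub x i j hij.ne] at hy ⊢
  refine conn_root hct _ hx hy ?_ ?_ ?_
  · refine ⟨D_mem _ ⟨i, j, hij.ne, Or.inr (Or.inl rfl)⟩, i, ?_, ?_⟩
    · simp [ee, hij.ne]
    · intro k hk; simp [ee, hk.ne, (hk.trans hij).ne]
  · rintro ⟨-, h⟩; exact hs (not_seg hct I i j hij h)
  · have ej : (ee i - ee j : V n) j = -1 := by simp [ee, hij.ne']
    have ei : (ee i - ee j : V n) i = 1 := by simp [ee, hij.ne]
    have n1 : ∀ k, (ee i - ee j : V n) ≠ sr ct k := by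
      intro k h; rw [h] at ej; have := sr_nonneg ct k j; linarith
    have n2 : ∀ k l, (ee i - ee j : V n) ≠ ee k + ee l := by
      intro k l h; rw [h] at ej
      have h1 := ee_nonneg k j; have h2 := ee_nonneg l j
      simp only [Pi.add_apply] at ej; linarith
    rintro ⟨s, hs1, hs2, a, ha, -, -, h⟩
    rcases h with ⟨k, l, -, -, -, -, h | h⟩ | ⟨k, l, -, -, -, h | h⟩ | ⟨k, l, hk, hl, hv, h | h⟩
    · exact n1 _ h
    · exact n2 _ _ h
    · exact n1 _ h
    · exact n2 _ _ h
    · exact n1 _ h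
    · have hk' : k = i := by
        by_contra hc
        rw [h] at ei
        have := ee_nonneg l i
        simp only [Pi.sub_apply, ee_ne (Ne.symm hc)] at ei; linarith
      have hl' : l = j := by
        by_contra hc
        rw [h] at ej
        have := ee_nonneg k j
        simp only [Pi.sub_apply, ee_ne (Ne.symm hc)] at ej; linarith
      subst hk' hl'
      rw [inSeg_iff hct I _ _ (by omega) le_rfl] at hl
      rcases hm with hm | hm
      · exact hm hl
      · apply hm
        rcases hv with ⟨h1, h2⟩ | ⟨h1, h2⟩ <;> rw [h1, h2] <;> simp

theorem conn_swap {n : ℕ} {ct : CType} (hct : ct = CType.B ∨ ct = CType.C) {I : Finset (Fin n)} {x : V n}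
    {i j : Fin n} (hs : segf I i ≠ segf I j)
    (hm : (segf I i ≠ mval n I ∧ segf I j ≠ mval n I) ∨ |x i| ≠ |x j|)
    (hx : Rg I x) (hy : Rg I (x ∘ Equiv.swap i j)) : Conn n ct I x (x ∘ Equiv.swap i j) := by
  rcases lt_trichotomy i j with h | h | h
  · exact conn_swap_lt hct h hs (by tauto) hx hy
  · subst h; exact absurd rfl hs
  · rw [Equiv.swap_comm] at hy ⊢
    exact conn_swap_lt hct h hs.symm (by
      rcases hm with h | h
      · exact Or.inl h.1
      · exact Or.inr h.symm) hx hy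

theorem conn_nsw {n : ℕ} {ct : CType} (hct : ct = CType.B ∨ ct = CType.C) {I : Finset (Fin n)} {x : V n}
    {i j : Fin n} (hij : i ≠ j) (hi : segf I i ≠ mval n I) (hj : segf I j ≠ mval n I)
    (hm : segf I i ≠ segf I j ∨ (x i ≠ 0 ∧ x j ≠ 0))
    (hx : Rg I x) (hy : Rg I (nsw x i j)) : Conn n ct I x (nsw x i j) := by
  wlog hlt : i < j generalizing i j with H
  · rw [nsw_comm] at hy ⊢
    exact H hij.symm hj hi (by tauto) hy (lt_of_le_of_ne (not_lt.1 hlt) hij.symm)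
  rw [← sRefl_add x i j hij] at hy ⊢
  have ei : (ee i + ee j : V n) i = 1 := by simp [ee, hij]
  have ej : (ee i + ee j : V n) j = 1 := by simp [ee, hij.symm]
  refine conn_root hct _ hx hy ?_ ?_ ?_
  · refine ⟨D_mem _ ⟨i, j, hij, Or.inl rfl⟩, i, ?_, ?_⟩
    · rw [ei]; norm_num
    · intro k hk; simp [ee, hk.ne, (hk.trans hlt).ne]
  · rintro ⟨-, h⟩
    exact hi (not_seg_top hct I i _ (fun k => add_nonneg (ee_nonneg i k) (ee_nonneg j k))
      (by show 0 < (ee i + ee j : V n) i; rw [ei]; norm_num) h)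
  · have n1 : ∀ k, (ee i + ee j : V n) ≠ sr ct k := by
      intro k h
      by_cases hk : i = k
      · rw [h, sr_ne ct (by rintro rfl; exact hij hk)] at ej; norm_num at ej
      · rw [h, sr_ne ct hk] at ei; norm_num at ei
    have n2 : ∀ k l, (ee i + ee j : V n) ≠ ee k - ee l := by
      intro k l h
      by_cases hk : k = l
      · rw [h, hk] at ei; simp at ei
      · have := congrFun h l
        have h1 := ee_nonneg i l; have h2 := ee_nonneg j l
        simp only [Pi.add_apply, Pi.sub_apply, ee_self, ee_ne (Ne.symm hk)] at this
        linarith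
    have n3 : ∀ k l, (ee i + ee j : V n) = ee k + ee l → (l = i ∨ l = j) ∧ (k = i ∨ k = j) := by
      intro k l h
      constructor
      · by_contra hc
        push Not at hc
        have := congrFun h l
        have h1 := ee_nonneg k l
        simp only [Pi.add_apply, ee_self, ee_ne hc.1, ee_ne hc.2] at this
        linarith
      · by_contra hc
        push Not at hc
        have := congrFun h k
        have h1 := ee_nonneg l k
        simp only [Pi.add_apply, ee_self, ee_ne hc.1, ee_ne hc.2] at this
        linarith
    rintro ⟨s, hs1, hs2, a, ha, -, -, h⟩
    rcases h with ⟨k, l, hk, hl, hka, hl0, h | h⟩ | ⟨k, l, -, hl, -, h | h⟩ | ⟨k, l, hk, hl, hv, h | h⟩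
    · exact n1 _ h
    · rw [inSeg_iff hct I _ _ hs1 hs2.le] at hk hl
      have hkl : k ≠ l := by rintro rfl; rw [hl0] at hka; simp at hka; linarith
      obtain ⟨h1 | h1, h2 | h2⟩ := n3 _ _ h <;> subst h1 <;> subst h2
      · exact hkl rfl
      · rcases hm with hm | hm
        · exact hm (hl.trans hk.symm)
        · exact hm.1 hl0
      · rcases hm with hm | hm
        · exact hm (hk.trans hl.symm)
        · exact hm.2 hl0
      · exact hkl rfl
    · exact n1 _ h
    · rw [inSeg_iff hct I _ _ (by omega) le_rfl] at hl
      rcases (n3 _ _ h).1 with h1 | h1 <;> subst h1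
      · exact hi hl
      · exact hj hl
    · exact n1 _ h
    · exact n2 _ _ h



/-- count of absolute values in a segment -/
noncomputable def cn {n : ℕ} (I : Finset (Fin n)) (x : V n) (s : ℕ) (a : ℝ) : ℕ :=
  (Finset.univ.filter (fun i : Fin n => segf I i = s ∧ |x i| = a)).card

/-- capacity -/
noncomputable def capf (n : ℕ) (I : Finset (Fin n)) (s : ℕ) (a : ℝ) : ℤ :=
  2 - (if s = mval n I then 1 else 0) - (if a = 0 then 1 else 0)

theorem cn_pos {n : ℕ} {I : Finset (Fin n)} {x : V n} {s : ℕ} {a : ℝ} (h : 1 ≤ cn I x s a) :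
    ∃ i, segf I i = s ∧ |x i| = a := by
  obtain ⟨i, hi⟩ := Finset.card_pos.1 h
  exact ⟨i, by simpa using hi⟩

theorem cn_ge1 {n : ℕ} {I : Finset (Fin n)} {x : V n} {s : ℕ} {a : ℝ} (i : Fin n) (h1 : segf I i = s)
    (h2 : |x i| = a) : 1 ≤ cn I x s a :=
  Finset.card_pos.2 ⟨i, by simp [h1, h2]⟩

theorem cn_ge2 {n : ℕ} {I : Finset (Fin n)} {x : V n} {s : ℕ} {a : ℝ} (i j : Fin n) (hij : i ≠ j)
    (h1 : segf I i = s) (h2 : |x i| = a) (h3 : segf I j = s) (h4 : |x j| = a) : 2 ≤ cn I x s a := by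
  have : 1 < cn I x s a := Finset.one_lt_card.2 ⟨i, by simp [h1, h2], j, by simp [h3, h4], hij⟩
  exact this

theorem cn_two {n : ℕ} {I : Finset (Fin n)} {x : V n} (hx : Rg I x) (i : Fin n)
    (h : 2 ≤ cn I x (segf I i) (|x i|)) : ∃ j, segf I j = segf I i ∧ x j = - x i := by
  obtain ⟨j, hj, hji⟩ := Finset.exists_mem_ne (Nat.lt_of_succ_le h) i
  simp only [Finset.mem_filter, Finset.mem_univ, true_and] at hj
  refine ⟨j, hj.1, ?_⟩
  rcases abs_eq_abs.1 hj.2 with h1 | h1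
  · exact absurd h1 (hx.1 j i hji hj.1)
  · exact h1

theorem cn_cap {n : ℕ} {I : Finset (Fin n)} {x : V n} (hx : Rg I x) (s : ℕ) (a : ℝ) :
    (cn I x s a : ℤ) ≤ capf n I s a := by
  unfold capf
  by_cases h0 : cn I x s a = 0
  · rw [h0]; split_ifs <;> norm_num
  obtain ⟨i, h1, h2⟩ := cn_pos (Nat.one_le_iff_ne_zero.2 h0)
  subst h1 h2
  have hle2 : cn I x (segf I i) (|x i|) ≤ 2 := by
    by_contra hc
    obtain ⟨p, q, r, hp, hq, hr, hpq, hpr, hqr⟩ := Finset.two_lt_card_iff.1 (not_le.1 hc)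
    simp only [Finset.mem_filter, Finset.mem_univ, true_and] at hp hq hr
    have a1 := hx.1 p q hpq (hp.1.trans hq.1.symm)
    have a2 := hx.1 p r hpr (hp.1.trans hr.1.symm)
    have a3 := hx.1 q r hqr (hq.1.trans hr.1.symm)
    rcases abs_eq_abs.1 (hp.2.trans hq.2.symm) with e | e
    · exact a1 e
    rcases abs_eq_abs.1 (hp.2.trans hr.2.symm) with e' | e'
    · exact a2 e'
    exact a3 (by linarith)
  have key : (segf I i = mval n I ∨ |x i| = 0) → cn I x (segf I i) (|x i|) ≤ 1 := by
    intro hc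
    by_contra h
    obtain ⟨p, hp, q, hq, hpq⟩ := Finset.one_lt_card.1 (not_le.1 h)
    simp only [Finset.mem_filter, Finset.mem_univ, true_and] at hp hq
    rcases hc with hc | hc
    · rcases abs_eq_abs.1 (hp.2.trans hq.2.symm) with e | e
      · exact hx.1 p q hpq (hp.1.trans hq.1.symm) e
      · exact hx.2.2 p q hpq (hp.1.trans hc) (hq.1.trans hc) e
    · rw [hc] at hp hq
      exact hx.1 p q hpq (hp.1.trans hq.1.symm) (by rw [abs_eq_zero.1 hp.2, abs_eq_zero.1 hq.2])
  by_cases hm : segf I i = mval n I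
  · have h0 : |x i| ≠ 0 := by
      rw [Ne, abs_eq_zero]; exact hx.2.1 i hm
    have := key (Or.inl hm)
    rw [if_pos hm, if_neg h0]; push_cast; omega
  · rw [if_neg hm]
    split_ifs with h
    · have := key (Or.inr h); omega
    · omega

theorem free_sign {n : ℕ} {I : Finset (Fin n)} {x : V n} {s : ℕ} (y : ℝ) (hs : s ≠ mval n I)
    (h : (cn I x s (|y|) : ℤ) < capf n I s (|y|)) :
    (∀ k, segf I k = s → x k ≠ y) ∨ (∀ k, segf I k = s → x k ≠ - y) := by
  by_contra hc
  push Not at hc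
  obtain ⟨⟨k, h1, h2⟩, l, h3, h4⟩ := hc
  unfold capf at h
  rw [if_neg hs] at h
  have g1 := cn_ge1 (x := x) (a := |y|) k h1 (by rw [h2])
  by_cases hy : |y| = 0
  · rw [if_pos hy] at h; omega
  · have := cn_ge2 (x := x) (a := |y|) k l (by
      rintro rfl; rw [h2] at h4; apply hy; rw [abs_eq_zero]; linarith) h1 (by rw [h2]) h3 (by rw [h4, abs_neg])
    rw [if_neg hy] at h; omega

theorem rg_repl {n : ℕ} {I : Finset (Fin n)} {x z : V n} (hx : Rg I x) (i j : Fin n)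
    (hs : segf I i ≠ segf I j)
    (hz : ∀ k, k ≠ i → k ≠ j → z k = x k)
    (h1 : ∀ k, segf I k = segf I i → x k ≠ z i)
    (h2 : ∀ k, segf I k = segf I j → x k ≠ z j)
    (h3 : segf I i ≠ mval n I)
    (h4 : segf I j = mval n I → z j ≠ 0 ∧ ∀ k, segf I k = mval n I → x k ≠ - z j) : Rg I z := by
  refine ⟨?_, ?_, ?_⟩
  · intro p q hpq hs' e
    by_cases p1 : p = i
    · subst p1
      have q2 : q ≠ j := by rintro rfl; exact hs hs'
      rw [hz q hpq.symm q2] at e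
      exact h1 q hs'.symm e.symm
    by_cases q1 : q = i
    · subst q1
      have q2 : p ≠ j := by rintro rfl; exact hs hs'.symm
      rw [hz p hpq q2] at e
      exact h1 p hs' e
    by_cases p2 : p = j
    · subst p2
      rw [hz q q1 hpq.symm] at e
      exact h2 q hs'.symm e.symm
    by_cases q2 : q = j
    · subst q2
      rw [hz p p1 hpq] at e
      exact h2 p hs' e
    rw [hz p p1 p2, hz q q1 q2] at e
    exact hx.1 p q hpq hs' e
  · intro p hp
    have p1 : p ≠ i := by rintro rfl; exact h3 hp
    by_cases p2 : p = j
    · subst p2; exact (h4 hp).1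
    · rw [hz p p1 p2]; exact hx.2.1 p hp
  · intro p q hpq hp hq e
    have p1 : p ≠ i := by rintro rfl; exact h3 hp
    have q1 : q ≠ i := by rintro rfl; exact h3 hq
    by_cases p2 : p = j
    · subst p2
      rw [hz q q1 hpq.symm] at e
      exact (h4 hp).2 q hq (by linarith)
    by_cases q2 : q = j
    · subst q2
      rw [hz p p1 hpq] at e
      exact (h4 hq).2 p hp e
    rw [hz p p1 p2, hz q q1 q2] at e
    exact hx.2.2 p q hpq hp hq e

/-- exchange conclusion -/
def Exch {n : ℕ} (ct : CType) (I : Finset (Fin n)) (x : V n) (s t : ℕ) (a b : ℝ) : Prop :=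
  ∃ z : V n, Rg I z ∧ Conn n ct I x z ∧ ∃ i j : Fin n, segf I i = s ∧ segf I j = t ∧
    |x i| = a ∧ |x j| = b ∧ ∀ k, |z k| = |x (Equiv.swap i j k)|

theorem Exch.symm {n : ℕ} {ct : CType} {I : Finset (Fin n)} {x : V n} {s t : ℕ} {a b : ℝ}
    (h : Exch ct I x s t a b) : Exch ct I x t s b a := by
  obtain ⟨z, h1, h2, i, j, h3, h4, h5, h6, h7⟩ := h
  exact ⟨z, h1, h2, j, i, h4, h3, h6, h5, fun k => by rw [h7, Equiv.swap_comm]⟩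

theorem exch_low {n : ℕ} {ct : CType} (hct : ct = CType.B ∨ ct = CType.C) {I : Finset (Fin n)} {x : V n}
    (hx : Rg I x) (i j : Fin n) (hs : segf I i ≠ segf I j) (hi : segf I i ≠ mval n I)
    (hj : segf I j ≠ mval n I)
    (h : ((∀ k, segf I k = segf I i → x k ≠ x j) ∧ (∀ k, segf I k = segf I j → x k ≠ x i)) ∨
      ((∀ k, segf I k = segf I i → x k ≠ - x j) ∧ (∀ k, segf I k = segf I j → x k ≠ - x i))) :
    Exch ct I x (segf I i) (segf I j) (|x i|) (|x j|) := by
  have hij : i ≠ j := by rintro rfl; exact hs rfl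
  rcases h with ⟨h1, h2⟩ | ⟨h1, h2⟩
  · have hz : Rg I (x ∘ Equiv.swap i j) := by
      refine rg_repl hx i j hs ?_ ?_ ?_ hi (fun h => absurd h hj)
      · intro k k1 k2; simp [Equiv.swap_apply_of_ne_of_ne k1 k2]
      · simpa using h1
      · simpa using h2
    exact ⟨_, hz, conn_swap hct hs (Or.inl ⟨hi, hj⟩) hx hz, i, j, rfl, rfl, rfl, rfl, fun k => rfl⟩
  · have e1 : nsw x i j i = - x j := by simp [nsw]
    have e2 : nsw x i j j = - x i := by simp [nsw, hij.symm]
    have e3 : ∀ k, k ≠ i → k ≠ j → nsw x i j k = x k := by intro k k1 k2; simp [nsw, k1, k2]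
    have hz : Rg I (nsw x i j) := by
      refine rg_repl hx i j hs e3 ?_ ?_ hi (fun h => absurd h hj)
      · rw [e1]; exact h1
      · rw [e2]; exact h2
    refine ⟨_, hz, conn_nsw hct hij hi hj (Or.inl hs) hx hz, i, j, rfl, rfl, rfl, rfl, fun k => ?_⟩
    by_cases k1 : k = i
    · subst k1; rw [e1]; simp
    by_cases k2 : k = j
    · subst k2; rw [e2]; simp
    rw [e3 k k1 k2, Equiv.swap_apply_of_ne_of_ne k1 k2]

theorem rg_flip {n : ℕ} {I : Finset (Fin n)} {x : V n} (hx : Rg I x) (j : Fin n)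
    (h : ∀ k, k ≠ j → segf I k = segf I j → x k ≠ - x j) : Rg I (Function.update x j (- x j)) := by
  have e1 : Function.update x j (- x j) j = - x j := by simp
  have e2 : ∀ k, k ≠ j → Function.update x j (- x j) k = x k := by intro k hk; simp [hk]
  generalize Function.update x j (- x j) = z at e1 e2
  refine ⟨?_, ?_, ?_⟩
  · intro p q hpq hs e
    by_cases p1 : p = j
    · subst p1; rw [e1, e2 q hpq.symm] at e; exact h q hpq.symm hs.symm e.symm
    by_cases q1 : q = j
    · subst q1; rw [e1, e2 p hpq] at e; exact h p hpq hs e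
    rw [e2 p p1, e2 q q1] at e; exact hx.1 p q hpq hs e
  · intro p hp
    by_cases p1 : p = j
    · subst p1; rw [e1]; exact neg_ne_zero.2 (hx.2.1 p hp)
    rw [e2 p p1]; exact hx.2.1 p hp
  · intro p q hpq hp hq e
    by_cases p1 : p = j
    · subst p1; rw [e1, e2 q hpq.symm] at e; exact hx.1 p q hpq (hp.trans hq.symm) (by linarith)
    by_cases q1 : q = j
    · subst q1; rw [e1, e2 p hpq] at e; exact hx.1 p q hpq (hp.trans hq.symm) (by linarith)
    rw [e2 p p1, e2 q q1] at e; exact hx.2.2 p q hpq hp hq e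

theorem rg_flip_top {n : ℕ} {I : Finset (Fin n)} {x : V n} (hx : Rg I x) (j : Fin n)
    (h : segf I j = mval n I) : Rg I (Function.update x j (- x j)) :=
  rg_flip hx j fun k hk hs => hx.2.2 k j hk (hs.trans h) h

theorem exch_top {n : ℕ} {ct : CType} (hct : ct = CType.B ∨ ct = CType.C) {I : Finset (Fin n)} {x : V n}
    (hx : Rg I x) (i j : Fin n) (hi : segf I i ≠ mval n I) (hj : segf I j = mval n I)
    (hab : |x i| ≠ |x j|)
    (h1 : (cn I x (segf I i) (|x j|) : ℤ) < capf n I (segf I i) (|x j|))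
    (h2 : (cn I x (segf I j) (|x i|) : ℤ) < capf n I (segf I j) (|x i|)) :
    Exch ct I x (segf I i) (segf I j) (|x i|) (|x j|) := by
  have hs : segf I i ≠ segf I j := by rw [hj]; exact hi
  have hij : i ≠ j := by rintro rfl; exact hs rfl
  have hx0 : |x i| ≠ 0 := by
    intro h0
    unfold capf at h2
    rw [if_pos hj, if_pos h0] at h2; omega
  have hno : ∀ k, segf I k = mval n I → |x k| ≠ |x i| := by
    intro k hk hc
    have := cn_ge1 k (hk.trans hj.symm) hc
    unfold capf at h2
    rw [if_pos hj, if_neg hx0] at h2; omega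
  have fin : ∀ y : V n, Rg I y → Conn n ct I x y → y i = x i → (∀ k, |y k| = |x k|) →
      (∀ k, segf I k = segf I i → y k ≠ y j) →
      Exch ct I x (segf I i) (segf I j) (|x i|) (|x j|) := by
    intro y hy hc hyi hab' hfree
    have hz : Rg I (y ∘ Equiv.swap i j) := by
      refine rg_repl hy i j hs ?_ ?_ ?_ hi ?_
      · intro k k1 k2; simp [Equiv.swap_apply_of_ne_of_ne k1 k2]
      · simpa using hfree
      · intro k hk e
        simp only [Function.comp, Equiv.swap_apply_right] at e
        exact hno k (hk.trans hj) (by rw [← hab' k, ← hab' i, e])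
      · intro _
        simp only [Function.comp, Equiv.swap_apply_right]
        refine ⟨?_, ?_⟩
        · rw [hyi]; exact abs_ne_zero.1 hx0
        · intro k hk e
          exact hno k hk (by rw [← hab' k, ← hab' i, e, abs_neg])
    refine ⟨_, hz, conn_trans hc (conn_swap hct hs (Or.inr (by rw [hab', hab']; exact hab)) hy hz), i, j, rfl, rfl, rfl, rfl, fun k => ?_⟩
    exact hab' _
  rcases free_sign (x j) hi h1 with h | h
  · exact fin x hx (conn_refl hct hx) rfl (fun _ => rfl) h
  · have hy := rg_flip_top hx j hj
    refine fin _ hy (conn_wi hct hx hy (wi_flip hct I x j hj)) (by simp [hij]) ?_ ?_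
    · intro k
      by_cases hk : k = j
      · subst hk; simp
      · simp [hk]
    · intro k hk
      have : k ≠ j := by rintro rfl; exact hs hk.symm
      simpa [this] using h k hk

theorem tau1 {A B C D : Prop} (h : ¬ ((A ∧ C) ∨ (B ∧ D))) (f : A ∨ B) (g : C ∨ D) :
    (A ∧ D) ∨ (B ∧ C) := by tauto
theorem tau2 {A B C D : Prop} (a : A) (b : B) (g : C ∨ D) : (A ∧ C) ∨ (B ∧ D) := by tauto
theorem tau3 {A B C D : Prop} (c : C) (d : D) (g : A ∨ B) : (A ∧ C) ∨ (B ∧ D) := by tauto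

theorem realize {n : ℕ} {ct : CType} (hct : ct = CType.B ∨ ct = CType.C) {I : Finset (Fin n)} {x : V n}
    (hx : Rg I x) (s t : ℕ) (a b : ℝ) (hst : s ≠ t) (hab : a ≠ b) (h1 : 1 ≤ cn I x s a)
    (h2 : 1 ≤ cn I x t b) (h3 : (cn I x s b : ℤ) < capf n I s b) (h4 : (cn I x t a : ℤ) < capf n I t a)
    (h5 : ¬ (cn I x s a = 1 ∧ cn I x t b = 1 ∧ cn I x s b = 1 ∧ cn I x t a = 1)) :
    Exch ct I x s t a b := by
  obtain ⟨i, rfl, rfl⟩ := cn_pos h1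
  obtain ⟨j, rfl, rfl⟩ := cn_pos h2
  by_cases hj : segf I j = mval n I
  · exact exch_top hct hx i j (by rw [← hj]; exact hst) hj hab h3 h4
  by_cases hi : segf I i = mval n I
  · exact (exch_top hct hx j i hj hi hab.symm h4 h3).symm
  by_cases hA : ((∀ k, segf I k = segf I i → x k ≠ x j) ∧ (∀ k, segf I k = segf I j → x k ≠ x i)) ∨
      ((∀ k, segf I k = segf I i → x k ≠ - x j) ∧ (∀ k, segf I k = segf I j → x k ≠ - x i))
  · exact exch_low hct hx i j hst hi hj hA
  have f1 := free_sign (x j) hi h3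
  have f2 := free_sign (x i) hj h4
  have hB : ((∀ k, segf I k = segf I i → x k ≠ x j) ∧ (∀ k, segf I k = segf I j → x k ≠ - x i)) ∨
      ((∀ k, segf I k = segf I i → x k ≠ - x j) ∧ (∀ k, segf I k = segf I j → x k ≠ x i)) := tau1 hA f1 f2
  have g1 : 1 ≤ cn I x (segf I i) (|x j|) := by
    by_contra hc
    have : ∀ k, segf I k = segf I i → |x k| ≠ |x j| := fun k hk e => hc (cn_ge1 k hk e)
    have u1 : ∀ k, segf I k = segf I i → x k ≠ x j := fun k hk e => this k hk (by rw [e])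
    have u2 : ∀ k, segf I k = segf I i → x k ≠ - x j := fun k hk e => this k hk (by rw [e, abs_neg])
    exact hA (tau2 u1 u2 f2)
  have g2 : 1 ≤ cn I x (segf I j) (|x i|) := by
    by_contra hc
    have : ∀ k, segf I k = segf I j → |x k| ≠ |x i| := fun k hk e => hc (cn_ge1 k hk e)
    have u1 : ∀ k, segf I k = segf I j → x k ≠ x i := fun k hk e => this k hk (by rw [e])
    have u2 : ∀ k, segf I k = segf I j → x k ≠ - x i := fun k hk e => this k hk (by rw [e, abs_neg])
    exact hA (tau3 u1 u2 f1)
  have c1 : cn I x (segf I i) (|x j|) = 1 := by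
    unfold capf at h3; split_ifs at h3 <;> omega
  have c2 : cn I x (segf I j) (|x i|) = 1 := by
    unfold capf at h4; split_ifs at h4 <;> omega
  have c3 : 2 ≤ cn I x (segf I i) (|x i|) ∨ 2 ≤ cn I x (segf I j) (|x j|) := by omega
  rcases c3 with c3 | c3
  · obtain ⟨i', e1, e2⟩ := cn_two hx i c3
    have := exch_low hct hx i' j (by rw [e1]; exact hst) (by rw [e1]; exact hi) hj (by
      rw [e1, e2, neg_neg]; exact hB)
    rw [e1, e2, abs_neg] at this
    exact this
  · obtain ⟨j', e1, e2⟩ := cn_two hx j c3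
    have := exch_low hct hx i j' (by rw [e1]; exact hst) hi (by rw [e1]; exact hj) (by
      rw [e1, e2, neg_neg]; exact hB.symm)
    rw [e1, e2, abs_neg] at this
    exact this

theorem cn_exch {n : ℕ} {I : Finset (Fin n)} {x z : V n} (i j : Fin n) (hij : i ≠ j)
    (hz : ∀ k, |z k| = |x (Equiv.swap i j k)|) (r : ℕ) (c : ℝ) :
    (cn I z r c : ℤ) = cn I x r c
      + ((if segf I i = r ∧ |x j| = c then 1 else 0) - (if segf I i = r ∧ |x i| = c then 1 else 0))
      + ((if segf I j = r ∧ |x i| = c then 1 else 0) - (if segf I j = r ∧ |x j| = c then 1 else 0)) := by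
  have e : ∀ y : V n, (cn I y r c : ℤ) = ∑ k, if segf I k = r ∧ |y k| = c then (1:ℤ) else 0 := by
    intro y; unfold cn; simp
  rw [add_assoc, ← sub_eq_iff_eq_add', e, e, ← Finset.sum_sub_distrib]
  rw [Fintype.sum_eq_add i j hij]
  · rw [hz i, hz j]; simp
  · intro k ⟨k1, k2⟩
    rw [hz k, Equiv.swap_apply_of_ne_of_ne k1 k2]; simp

theorem tot_exch {n : ℕ} {x z : V n} (e : Equiv.Perm (Fin n))
    (hz : ∀ k, |z k| = |x (e k)|) (c : ℝ) :
    (Finset.univ.filter (fun i : Fin n => |z i| = c)).card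
      = (Finset.univ.filter (fun i : Fin n => |x i| = c)).card := by
  refine Finset.card_bij (fun k _ => e k) ?_ ?_ ?_
  · intro k hk; simpa [hz] using hk
  · intro k _ l _ h; exact e.injective h
  · intro k hk; exact ⟨e.symm k, by simpa [hz] using hk, by simp⟩

theorem worb_tot {n : ℕ} {ct : CType} (hct : ct = CType.B ∨ ct = CType.C) {x y : V n}
    (h : WOrb n ct x y) (c : ℝ) :
    (Finset.univ.filter (fun i : Fin n => |y i| = c)).card
      = (Finset.univ.filter (fun i : Fin n => |x i| = c)).card := by
  induction h with
  | refl => rfl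
  | tail _ h ih =>
    rw [← ih]
    obtain ⟨i, -, rfl⟩ := h
    by_cases hi : i.1 + 1 < n
    · rw [alpha_lt ct i hi, sRefl_sub _ _ _ (by intro h; have := congrArg Fin.val h; simp at this)]
      exact tot_exch _ (fun k => rfl) c
    · rw [alpha_last hct i hi, sRefl_sr]
      refine tot_exch (Equiv.refl _) (fun k => ?_) c
      by_cases hk : k = i
      · subst hk; simp
      · simp [hk]



/-- same absolute value counts -/
def Tot {n : ℕ} (l x : V n) : Prop := ∀ c : ℝ,
  (Finset.univ.filter (fun i : Fin n => |x i| = c)).card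
      = (Finset.univ.filter (fun i : Fin n => |l i| = c)).card

theorem tot_mem {n : ℕ} {l x : V n} (h : Tot l x) (i : Fin n) :
    |x i| ∈ Finset.univ.image (fun k => |l k|) := by
  have h1 : 0 < (Finset.univ.filter (fun k : Fin n => |x k| = |x i|)).card :=
    Finset.card_pos.2 ⟨i, by simp⟩
  rw [h] at h1
  obtain ⟨k, hk⟩ := Finset.card_pos.1 h1
  simp only [Finset.mem_filter, Finset.mem_univ, true_and] at hk
  exact Finset.mem_image.2 ⟨k, by simp, hk⟩

theorem reach_mu {n : ℕ} {ct : CType} (hct : ct = CType.B ∨ ct = CType.C) (I : Finset (Fin n)) (l : V n)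
    (x0 : V n) (hx0 : Rg I x0) (ht0 : Tot l x0) :
    ∃ mu : V n, Rg I mu ∧ Tot l mu ∧ ∀ x, Rg I x → Tot l x →
      ∃ y, Rg I y ∧ Conn n ct I x y ∧ ∀ s a, cn I y s a = cn I mu s a := by
  set K : Finset ℝ := Finset.univ.image (fun k => |l k|) with hK
  have hm1 : 1 ≤ mval n I := by rw [mval_eq]; omega
  have key := abs_main (X := {x : V n // Rg I x ∧ Tot l x})
    (ρ := {s // s ∈ Finset.Icc 1 (mval n I)}) (κ := {a // a ∈ K})
    ⟨mval n I, Finset.mem_Icc.2 ⟨hm1, le_rfl⟩⟩ (fun a => if a.1 = 0 then 1 else 0)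
    (by intro a; split_ifs <;> simp)
    (fun x y => Conn n ct I x.1 y.1)
    (by intro x; exact conn_refl hct x.2.1)
    (by intro x y w h1 h2; exact conn_trans h1 h2)
    (fun x s a => (cn I x.1 s.1 a.1 : ℤ))
    (fun s a => capf n I s.1 a.1)
    (by intro s a; unfold capf; simp only [Subtype.ext_iff])
    (by intro x s a; exact Int.natCast_nonneg _)
    (by intro x s a; exact cn_cap x.2.1 _ _)
    (by
      have : ∀ (x : {x : V n // Rg I x ∧ Tot l x}) (s : {s // s ∈ Finset.Icc 1 (mval n I)}),
          ∑ a : {a // a ∈ K}, (cn I x.1 s.1 a.1 : ℤ)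
            = (Finset.univ.filter (fun i : Fin n => segf I i = s.1)).card := by
        intro x s
        rw [Finset.sum_coe_sort K (fun a => (cn I x.1 s.1 a : ℤ))]
        rw [Finset.card_eq_sum_card_fiberwise (f := fun i => |x.1 i|) (t := K)
          (fun i _ => tot_mem x.2.2 i)]
        push_cast
        refine Finset.sum_congr rfl fun a _ => ?_
        rw [Finset.filter_filter]; rfl
      intro x y s; rw [this, this])
    (by
      have : ∀ (x : {x : V n // Rg I x ∧ Tot l x}) (a : {a // a ∈ K}),
          ∑ s : {s // s ∈ Finset.Icc 1 (mval n I)}, (cn I x.1 s.1 a.1 : ℤ)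
            = (Finset.univ.filter (fun i : Fin n => |l i| = a.1)).card := by
        intro x a
        rw [Finset.sum_coe_sort (Finset.Icc 1 (mval n I)) (fun s => (cn I x.1 s a.1 : ℤ))]
        rw [← x.2.2 a.1]
        rw [Finset.card_eq_sum_card_fiberwise (f := fun i => segf I i) (t := Finset.Icc 1 (mval n I))
          (fun i _ => Finset.mem_coe.2 (Finset.mem_Icc.2 ⟨segf_pos I i, segf_le I i⟩))]
        push_cast
        refine Finset.sum_congr rfl fun s _ => ?_
        rw [Finset.filter_filter]; unfold cn; simp only [and_comm]
      intro x y s; rw [this, this])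
    (by
      intro x s t a b hst hab h1 h2 h3 h4 h5
      have hst' : s.1 ≠ t.1 := fun h => hst (Subtype.ext h)
      have hab' : a.1 ≠ b.1 := fun h => hab (Subtype.ext h)
      obtain ⟨z, hz, hc, i, j, e1, e2, e3, e4, e5⟩ := realize hct x.2.1 s.1 t.1 a.1 b.1 hst' hab'
        (by exact_mod_cast h1) (by exact_mod_cast h2) h3 h4
        (fun h => h5 ⟨by exact_mod_cast h.1, by exact_mod_cast h.2.1, by exact_mod_cast h.2.2.1,
          by exact_mod_cast h.2.2.2⟩)
      have hij : i ≠ j := by rintro rfl; exact hst' (e1.symm.trans e2)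
      have ce := cn_exch (I := I) i j hij e5
      rw [e1, e2, e3, e4] at ce
      refine ⟨⟨z, hz, fun c => (tot_exch _ e5 c).trans (x.2.2 c)⟩, hc, ?_, ?_, ?_, ?_, ?_⟩
      · have := ce s.1 a.1; simp [hst'.symm, hab'.symm] at this; linarith
      · have := ce s.1 b.1; simp [hst'.symm, hab'] at this; linarith
      · have := ce t.1 a.1; simp [hst', hab'.symm] at this; linarith
      · have := ce t.1 b.1; simp [hst', hab'] at this; linarith
      · intro r c hrc
        have h0 := ce r.1 c.1
        simp only [Subtype.ext_iff] at hrc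
        have n1 : ¬ (s.1 = r.1 ∧ b.1 = c.1) := fun h => hrc ⟨Or.inl h.1.symm, Or.inr h.2.symm⟩
        have n2 : ¬ (s.1 = r.1 ∧ a.1 = c.1) := fun h => hrc ⟨Or.inl h.1.symm, Or.inl h.2.symm⟩
        have n3 : ¬ (t.1 = r.1 ∧ a.1 = c.1) := fun h => hrc ⟨Or.inr h.1.symm, Or.inl h.2.symm⟩
        have n4 : ¬ (t.1 = r.1 ∧ b.1 = c.1) := fun h => hrc ⟨Or.inr h.1.symm, Or.inr h.2.symm⟩
        rw [if_neg n1, if_neg n2, if_neg n3, if_neg n4] at h0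
        simpa using h0)
    ⟨x0, hx0, ht0⟩
  obtain ⟨mu, hmu⟩ := key
  refine ⟨mu.1, mu.2.1, mu.2.2, fun x hx ht => ?_⟩
  obtain ⟨y, hc, hM⟩ := hmu ⟨x, hx, ht⟩
  refine ⟨y.1, y.2.1, hc, fun s a => ?_⟩
  by_cases h : s ∈ Finset.Icc 1 (mval n I) ∧ a ∈ K
  · have := congrFun (congrFun hM ⟨s, h.1⟩) ⟨a, h.2⟩
    exact_mod_cast this
  · have : ∀ w : {x : V n // Rg I x ∧ Tot l x}, cn I w.1 s a = 0 := by
      intro w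
      by_contra hc
      obtain ⟨i, h1, h2⟩ := cn_pos (Nat.one_le_iff_ne_zero.2 hc)
      subst h1 h2
      exact h ⟨Finset.mem_Icc.2 ⟨segf_pos I i, segf_le I i⟩, tot_mem w.2.2 i⟩
    rw [this, this]



theorem rg_perm {n : ℕ} {I : Finset (Fin n)} {x : V n} (hx : Rg I x) (e : Equiv.Perm (Fin n))
    (he : ∀ k, segf I (e k) = segf I k) : Rg I (x ∘ e) := by
  refine ⟨?_, ?_, ?_⟩
  · intro i j hij hs
    exact hx.1 _ _ (e.injective.ne hij) (by rw [he, he, hs])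
  · intro i hi; exact hx.2.1 _ ((he i).trans hi)
  · intro i j hij hi hj
    exact hx.2.2 _ _ (e.injective.ne hij) ((he i).trans hi) ((he j).trans hj)

theorem segf_swap {n : ℕ} {I : Finset (Fin n)} {i j : Fin n} (h : segf I i = segf I j) (k : Fin n) :
    segf I (Equiv.swap i j k) = segf I k := by
  by_cases k1 : k = i
  · subst k1; simp [h]
  by_cases k2 : k = j
  · subst k2; simp [h]
  rw [Equiv.swap_apply_of_ne_of_ne k1 k2]

theorem align {n : ℕ} {ct : CType} (hct : ct = CType.B ∨ ct = CType.C) {I : Finset (Fin n)} {mu : V n} :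
    ∀ N : ℕ, ∀ y : V n, Rg I y → (∀ s a, cn I y s a = cn I mu s a) →
      (Finset.univ.filter (fun i => |y i| ≠ |mu i|)).card ≤ N →
      ∃ z, Rg I z ∧ Conn n ct I y z ∧ ∀ i, |z i| = |mu i| := by
  intro N
  induction N with
  | zero =>
    intro y hy hc h
    refine ⟨y, hy, conn_refl hct hy, fun i => ?_⟩
    by_contra hi
    have : i ∈ Finset.univ.filter (fun i => |y i| ≠ |mu i|) := by simp [hi]
    rw [Finset.card_eq_zero.1 (Nat.le_zero.1 h)] at this
    simp at this
  | succ N ih =>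
    intro y hy hc h
    by_cases hall : ∀ i, |y i| = |mu i|
    · exact ⟨y, hy, conn_refl hct hy, hall⟩
    push Not at hall
    obtain ⟨i, hi⟩ := hall
    have : ∃ j, segf I j = segf I i ∧ |y j| = |mu i| ∧ |mu j| ≠ |mu i| := by
      by_contra hno
      push Not at hno
      have hsub : Finset.univ.filter (fun k : Fin n => segf I k = segf I i ∧ |y k| = |mu i|) ⊆
          Finset.univ.filter (fun k : Fin n => segf I k = segf I i ∧ |mu k| = |mu i|) := by
        intro k hk
        simp only [Finset.mem_filter, Finset.mem_univ, true_and] at hk ⊢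
        exact ⟨hk.1, hno k hk.1 hk.2⟩
      have heq := Finset.eq_of_subset_of_card_le hsub (hc (segf I i) (|mu i|)).ge
      have : i ∈ Finset.univ.filter (fun k : Fin n => segf I k = segf I i ∧ |y k| = |mu i|) := by
        rw [heq]; simp
      simp only [Finset.mem_filter, Finset.mem_univ, true_and] at this
      exact hi this
    obtain ⟨j, hj1, hj2, hj3⟩ := this
    have hij : i ≠ j := by rintro rfl; exact hj3 rfl
    have hz := rg_perm hy (Equiv.swap i j) (segf_swap hj1.symm)
    have hcn : ∀ s a, cn I (y ∘ Equiv.swap i j) s a = cn I mu s a := by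
      intro s a
      have := cn_exch (I := I) (x := y) (z := y ∘ Equiv.swap i j) i j hij (fun k => rfl) s a
      rw [hj1] at this
      rw [← hc s a]
      omega
    obtain ⟨z, h1, h2, h3⟩ := ih _ hz hcn (by
      refine Nat.le_of_lt_succ (lt_of_lt_of_le (Finset.card_lt_card ?_) h)
      rw [Finset.ssubset_iff_of_subset]
      · exact ⟨i, by simp [hi], by simp [hj2]⟩
      · intro k hk
        simp only [Finset.mem_filter, Finset.mem_univ, true_and, Function.comp] at hk ⊢
        by_cases k1 : k = i
        · subst k1; exact hi
        by_cases k2 : k = j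
        · subst k2; rw [hj2]; exact hj3.symm
        rwa [Equiv.swap_apply_of_ne_of_ne k1 k2] at hk)
    exact ⟨z, h1, conn_trans (conn_wi hct hy hz (wi_swap ct I y i j hj1.symm)) h2, h3⟩

/-- lonely nonzero entry -/
def Lone {n : ℕ} (I : Finset (Fin n)) (mu : V n) (i : Fin n) : Prop :=
  segf I i ≠ mval n I ∧ mu i ≠ 0 ∧ ∀ k, segf I k = segf I i → mu k ≠ - mu i

theorem lone_abs {n : ℕ} {I : Finset (Fin n)} {mu : V n} (hmu : Rg I mu) {i : Fin n} (h : Lone I mu i)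
    {l : Fin n} (hl : l ≠ i) (hs : segf I l = segf I i) : |mu l| ≠ |mu i| := by
  intro e
  rcases abs_eq_abs.1 e with e | e
  · exact hmu.1 l i hl hs e
  · exact h.2.2 l hs e

theorem signs {n : ℕ} {ct : CType} (hct : ct = CType.B ∨ ct = CType.C) {I : Finset (Fin n)} {mu : V n}
    (hmu : Rg I mu) (ks : ℕ → Fin n) (hks : ∀ s, 1 ≤ s → s < mval n I → segf I (ks s) = s)
    (hks2 : ∀ i, Lone I mu i → Lone I mu (ks (segf I i))) :
    ∀ N : ℕ, ∀ y : V n, Rg I y → (∀ i, |y i| = |mu i|) →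
      (Finset.univ.filter (fun i => y i ≠ mu i ∧ ¬ (Lone I mu i ∧ i = ks (segf I i)))).card ≤ N →
      ∃ z, Rg I z ∧ Conn n ct I y z ∧ (∀ i, |z i| = |mu i|) ∧
        ∀ i, z i ≠ mu i → Lone I mu i ∧ i = ks (segf I i) := by
  intro N
  induction N with
  | zero =>
    intro y hy hab h
    refine ⟨y, hy, conn_refl hct hy, hab, fun i hi => ?_⟩
    by_contra hc
    have : i ∈ Finset.univ.filter (fun i => y i ≠ mu i ∧ ¬ (Lone I mu i ∧ i = ks (segf I i))) := by
      simp only [Finset.mem_filter, Finset.mem_univ, true_and]; exact ⟨hi, hc⟩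
    rw [Finset.card_eq_zero.1 (Nat.le_zero.1 h)] at this
    simp at this
  | succ N ih =>
    intro y hy hab h
    by_cases hall : ∀ i, y i ≠ mu i → Lone I mu i ∧ i = ks (segf I i)
    · exact ⟨y, hy, conn_refl hct hy, hab, hall⟩
    rw [not_forall] at hall
    obtain ⟨i, hi⟩ := hall
    rw [Classical.not_imp] at hi
    obtain ⟨hi1, hi2⟩ := hi
    have hyi : y i = - mu i := (abs_eq_abs.1 (hab i)).resolve_left hi1
    have step : ∀ w : V n, Rg I w → Conn n ct I y w → (∀ k, |w k| = |mu k|) → w i = mu i →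
        (∀ k, k ≠ i → w k = y k ∨ w k = mu k ∨ (Lone I mu k ∧ k = ks (segf I k))) →
        ∃ z, Rg I z ∧ Conn n ct I y z ∧ (∀ i, |z i| = |mu i|) ∧
        ∀ i, z i ≠ mu i → Lone I mu i ∧ i = ks (segf I i) := by
      intro w hw hyw hwab hwi hwk
      obtain ⟨z, h1, h2, h3⟩ := ih w hw hwab (by
        refine Nat.le_of_lt_succ (lt_of_lt_of_le (Finset.card_lt_card ?_) h)
        rw [Finset.ssubset_iff_of_subset]
        · exact ⟨i, by simp only [Finset.mem_filter, Finset.mem_univ, true_and]; exact ⟨hi1, hi2⟩,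
            by simp [hwi]⟩
        · intro k hk
          simp only [Finset.mem_filter, Finset.mem_univ, true_and] at hk ⊢
          refine ⟨?_, hk.2⟩
          by_cases k1 : k = i
          · subst k1; exact hi1
          rcases hwk k k1 with e | e | e
          · rw [← e]; exact hk.1
          · exact absurd e hk.1
          · exact absurd e hk.2)
      exact ⟨z, h1, conn_trans hyw h2, h3⟩
    have abs_up : ∀ (x : V n) (j k : Fin n), |Function.update x j (- x j) k| = |x k| := by
      intro x j k
      by_cases hk : k = j
      · subst hk; simp
      · simp [hk]
    by_cases hm : segf I i = mval n I
    · have hw := rg_flip_top hy i hm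
      refine step _ hw (conn_wi hct hy hw (wi_flip hct I y i hm)) ?_ (by simp [hyi]) ?_
      · intro k; rw [abs_up, hab]
      · intro k hk; left; simp [hk]
    have hmi0 : mu i ≠ 0 := by
      intro h0; apply hi1; rw [hyi, h0, neg_zero]
    by_cases hL : Lone I mu i
    · set k := ks (segf I i) with hk
      have hik : i ≠ k := fun e => hi2 ⟨hL, e⟩
      have hkL : Lone I mu k := hks2 i hL
      have hks' : segf I k = segf I i := hks _ (segf_pos I i) (lt_of_le_of_ne (segf_le I i) hm)
      have hyne : ∀ l j, l ≠ j → segf I l = segf I j → Lone I mu j → |y l| ≠ |y j| := by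
        intro l j h1 h2 h3
        rw [hab, hab]; exact lone_abs hmu h3 h1 h2
      have r1 : Rg I (Function.update y i (- y i)) := rg_flip hy i (fun l h1 h2 e =>
        hyne l i h1 h2 hL (by rw [e, abs_neg]))
      have r2 := rg_flip r1 k (fun l h1 h2 e => hyne l k h1 h2 hkL (by
        rw [← abs_up y i l, ← abs_up y i k, e, abs_neg]))
      set w := Function.update (Function.update y i (- y i)) k (- (Function.update y i (- y i)) k) with hw
      have wk : w k = - y k := by simp [hw, hik.symm]
      have wi : w i = - y i := by simp [hw, hik]
      have wl : ∀ l, l ≠ i → l ≠ k → w l = y l := by intro l h1 h2; simp [hw, h1, h2]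
      have r3 := rg_perm r2 (Equiv.swap i k) (segf_swap hks'.symm)
      have e3 : w ∘ Equiv.swap i k = nsw y i k := by
        funext l
        by_cases l1 : l = i
        · subst l1; simp [nsw, wk]
        by_cases l2 : l = k
        · rw [l2]; simp [nsw, wi, hik.symm]
        simp only [Function.comp]
        rw [Equiv.swap_apply_of_ne_of_ne l1 l2, wl l l1 l2]; simp [nsw, l1, l2]
      have e4 : nsw y i k ∘ Equiv.swap i k = w := by
        rw [← e3]; funext l; simp
      rw [e3] at r3
      have y0 : ∀ j, mu j ≠ 0 → y j ≠ 0 := by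
        intro j hj h0; have := hab j; rw [h0, abs_zero] at this; exact hj (abs_eq_zero.1 this.symm)
      have c1 := conn_nsw hct hik hm (by rw [hks']; exact hm)
        (Or.inr ⟨y0 i hmi0, y0 k hkL.2.1⟩) hy r3
      have c2 := wi_swap ct I (nsw y i k) i k hks'.symm
      rw [e4] at c2
      refine step w r2 (conn_trans c1 (conn_wi hct r3 r2 c2)) ?_ (by rw [wi, hyi, neg_neg]) ?_
      · intro l; rw [hw, abs_up, abs_up, hab]
      · intro l hl
        by_cases l2 : l = k
        · right; right
          rw [l2]
          exact ⟨hkL, by rw [hks']⟩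
        · left; exact wl l hl l2
    · have : ∃ k, segf I k = segf I i ∧ mu k = - mu i := by
        by_contra hno
        push Not at hno
        exact hL ⟨hm, hmi0, hno⟩
      obtain ⟨k, hk1, hk2⟩ := this
      have hki : k ≠ i := by
        rintro rfl; apply hmi0; linarith
      have hyk : y k = mu i := by
        have h1 : |y k| = |mu i| := by rw [hab, hk2, abs_neg]
        rcases abs_eq_abs.1 h1 with e | e
        · exact e
        · exact absurd (e.trans hyi.symm) (hy.1 k i hki hk1)
      have hw := rg_perm hy (Equiv.swap i k) (segf_swap hk1.symm)
      have hwk : ∀ l, l ≠ i → (y ∘ Equiv.swap i k) l = y l ∨ (y ∘ Equiv.swap i k) l = mu l := by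
        intro l hl
        by_cases l2 : l = k
        · right; rw [l2]; simp [hyi, hk2]
        · left; simp [Equiv.swap_apply_of_ne_of_ne hl l2]
      have hwi : (y ∘ Equiv.swap i k) i = mu i := by simp [hyk]
      refine step _ hw (conn_wi hct hy hw (wi_swap ct I y i k hk1.symm)) ?_ hwi ?_
      · intro l
        by_cases l1 : l = i
        · rw [l1, hwi]
        · rcases hwk l l1 with e | e
          · rw [e, hab]
          · rw [e]
      · intro l hl
        rcases hwk l hl with e | e
        · exact Or.inl e
        · exact Or.inr (Or.inl e)

theorem flips_eval {n : ℕ} {I : Finset (Fin n)} (ks : ℕ → Fin n) (eps : ℕ → Bool) (mu : V n)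
    (hks : ∀ s, 1 ≤ s → s < mval n I → segf I (ks s) = s) :
    ∀ r, r ≤ mval n I - 1 → ∀ l, applyFlips n ks eps r mu l =
      if segf I l ≤ r ∧ l = ks (segf I l) ∧ eps (segf I l) = true then - mu l else mu l := by
  intro r
  induction r with
  | zero =>
    intro _ l
    have := segf_pos I l
    rw [if_neg (by omega)]; rfl
  | succ r ih =>
    intro hr l
    have ih' := ih (by omega)
    have hk := hks (r+1) (by omega) (by omega)
    simp only [applyFlips]
    by_cases he : eps (r+1) = true
    · rw [if_pos he, sRefl_ee]
      by_cases hl : l = ks (r+1)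
      · have hsl : segf I l = r + 1 := by rw [hl, hk]
        rw [if_pos ⟨hsl.le, by rw [hsl]; exact hl, by rw [hsl]; exact he⟩]
        rw [← hl, Function.update_self, ih', if_neg (by omega)]
      · rw [Function.update_of_ne hl, ih']
        congr 1
        apply propext
        constructor
        · rintro ⟨a, b⟩; exact ⟨by omega, b⟩
        · rintro ⟨a, b, c⟩
          refine ⟨?_, b, c⟩
          by_contra hc
          have : segf I l = r + 1 := by omega
          rw [this] at b; exact hl b
    · rw [if_neg he, ih']
      congr 1
      apply propext
      constructor
      · rintro ⟨a, b⟩; exact ⟨by omega, b⟩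
      · rintro ⟨a, b, c⟩
        refine ⟨?_, b, c⟩
        by_contra hc
        have : segf I l = r + 1 := by omega
        rw [this] at c; exact he c

theorem ks_exists {n : ℕ} (hn : 0 < n) (I : Finset (Fin n)) (mu : V n) :
    ∃ ks : ℕ → Fin n, (∀ s, 1 ≤ s → s < mval n I → segf I (ks s) = s) ∧
      ∀ i, Lone I mu i → Lone I mu (ks (segf I i)) := by
  have : ∀ s : ℕ, ∃ k : Fin n, (1 ≤ s → s < mval n I → segf I k = s) ∧
      ∀ i, segf I i = s → Lone I mu i → Lone I mu k := by
    intro s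
    by_cases h : ∃ i, segf I i = s ∧ Lone I mu i
    · obtain ⟨i, h1, h2⟩ := h
      exact ⟨i, fun _ _ => h1, fun _ _ _ => h2⟩
    · push Not at h
      by_cases hs : 1 ≤ s ∧ s < mval n I
      · obtain ⟨k, hk⟩ := seg_exists I s hs.1 hs.2
        exact ⟨k, fun _ _ => hk, fun i h1 h2 => absurd h2 (h i h1)⟩
      · exact ⟨⟨0, hn⟩, fun h1 h2 => absurd ⟨h1, h2⟩ hs, fun i h1 h2 => absurd h2 (h i h1)⟩
  choose ks h1 h2 using this
  exact ⟨ks, h1, fun i hi => h2 _ i rfl hi⟩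

theorem fin_main (n : ℕ) (hn : 0 < n) (ct : CType)
    (hct : ct = CType.B ∨ ct = CType.C) (I : Finset (Fin n)) (lbar : V n) :
    ∃ (mu : V n) (ks : ℕ → Fin n),
      RegI n ct I mu ∧
      (∀ s : ℕ, 1 ≤ s → s < mval n I → InSeg n ct I s (ks s)) ∧
      ∀ lam : V n, WOrb n ct lbar lam → RegI n ct I lam →
        ∃ eps : ℕ → Bool,
          Conn n ct I lam (applyFlips n ks eps (mval n I - 1) mu) ∧
          (∀ s : ℕ, 1 ≤ s → s < mval n I → eps s = true →
            mu (ks s) ≠ 0 ∧ RegI n ct I (sRefl (ee (ks s)) mu)) := by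
  by_cases hex : ∃ x0, Rg I x0 ∧ Tot lbar x0
  · obtain ⟨x0, h1, h2⟩ := hex
    obtain ⟨mu, hmu, -, hreach⟩ := reach_mu hct I lbar x0 h1 h2
    obtain ⟨ks, hks, hks2⟩ := ks_exists hn I mu
    refine ⟨mu, ks, (regI_iff hct I mu).2 hmu,
      fun s h1 h2 => (inSeg_iff hct I s _ h1 h2.le).2 (hks s h1 h2), ?_⟩
    intro lam hw hreg
    obtain ⟨y, hy, hc1, hcn⟩ := hreach lam ((regI_iff hct I lam).1 hreg) (fun c => worb_tot hct hw c)
    obtain ⟨y2, hy2, hc2, hab⟩ := align hct _ y hy hcn le_rfl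
    obtain ⟨z, hz, hc3, habz, hgood⟩ := signs hct hmu ks hks hks2 _ y2 hy2 hab le_rfl
    refine ⟨fun s => decide (z (ks s) ≠ mu (ks s)), ?_, ?_⟩
    · have : applyFlips n ks (fun s => decide (z (ks s) ≠ mu (ks s))) (mval n I - 1) mu = z := by
        funext l
        rw [flips_eval (I := I) ks _ mu hks _ le_rfl l]
        by_cases hl : z l = mu l
        · rw [if_neg, hl]
          rintro ⟨-, a, b⟩
          rw [← a] at b
          simp [hl] at b
        · have g := hgood l hl
          rw [if_pos]
          · exact ((abs_eq_abs.1 (habz l)).resolve_left hl).symm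
          · refine ⟨?_, g.2, ?_⟩
            · have := segf_le I l
              have := g.1.1
              omega
            · rw [← g.2]; simpa using hl
      rw [this]
      exact conn_trans hc1 (conn_trans hc2 hc3)
    · intro s hs1 hs2 he
      have g := hgood (ks s) (by simpa using he)
      refine ⟨g.1.2.1, ?_⟩
      rw [regI_iff hct, sRefl_ee]
      exact rg_flip hmu _ (fun k _ h => g.1.2.2 k h)
  · set mu : V n := fun i => (i.1 : ℝ) + 1 with hmu
    have pos : ∀ i, 0 < mu i := by intro i; simp only [hmu]; positivity
    obtain ⟨ks, hks, -⟩ := ks_exists hn I mu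
    refine ⟨mu, ks, (regI_iff hct I mu).2 ⟨?_, ?_, ?_⟩,
      fun s h1 h2 => (inSeg_iff hct I s _ h1 h2.le).2 (hks s h1 h2), ?_⟩
    · intro i j hij _ e
      simp only [hmu] at e
      exact hij (Fin.ext (by exact_mod_cast add_right_cancel e))
    · intro i _; exact (pos i).ne'
    · intro i j _ _ _ e
      have := pos i; have := pos j; linarith
    · intro lam hw hreg
      exact absurd ⟨lam, (regI_iff hct I lam).1 hreg, fun c => worb_tot hct hw c⟩ hex


/-- Lemma 6.13 / `bkswlem5`. -/
theorem statement15 (n : ℕ) (hn : 0 < n) (ct : CType)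
    (hct : ct = CType.B ∨ ct = CType.C)
    (I J : Finset (Fin n)) (lbar : V n)
    (hdom : DominantW n ct lbar) (hint : IntegralW n ct lbar)
    (hJ : ∀ i : Fin n, i ∈ J ↔ inn lbar (alphaR n ct i) = 0) :
    ∃ (mu : V n) (ks : ℕ → Fin n),
      RegI n ct I mu ∧
      (∀ s : ℕ, 1 ≤ s → s < mval n I → InSeg n ct I s (ks s)) ∧
      ∀ lam : V n, WOrb n ct lbar lam → RegI n ct I lam →
        ∃ eps : ℕ → Bool,
          Conn n ct I lam (applyFlips n ks eps (mval n I - 1) mu) ∧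
          (∀ s : ℕ, 1 ≤ s → s < mval n I → eps s = true →
            mu (ks s) ≠ 0 ∧ RegI n ct I (sRefl (ee (ks s)) mu)) := by
  exact fin_main n hn ct hct I lbar

end JantzenBlocks
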